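/- Let σ ∈ C³_b(W², L(ℝ^d, W)), 1/3 < β < γ ≤ 1/2, let 𝐗 be a delayed γ-rough path with delay r > 0, and fix ξ ∈ 𝒟_X^β([−r,0], W). For every 0 ≤ s ≤ r and x ∈ W, the 'frozen-delay' equation y_t = x + ∫_s^t σ(y_τ, ξ_{τ−r}) d𝐗_τ, t ∈ [s,r], has a unique solution φ̄(s,·,x) ∈ 𝒟_X^β([s,r], W) with Gubinelli derivative σ(y_·, ξ_{·−r}), and the flow property φ̄(τ, t, x) = φ̄(s, t, φ̄(τ, s, x)) holds for all 0 ≤ τ ≤ s ≤ t ≤ r and x ∈ W. -/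

import Mathlib

noncomputable section

namespace SDDE

open Set

variable {E E₁ E₂ : Type*}

/-- `f` is `γ`-Hölder continuous on `I`. -/
def HolderOn [NormedAddCommGroup E] (γ : ℝ) (I : Set ℝ) (f : ℝ → E) : Prop :=
  ∃ C : ℝ, ∀ s ∈ I, ∀ t ∈ I, ‖f t - f s‖ ≤ C * |t - s| ^ γ

/-- The `γ`-Hölder seminorm of `f` on `I`. -/
def holderNorm [NormedAddCommGroup E] (γ : ℝ) (I : Set ℝ) (f : ℝ → E) : ℝ :=
  sInf {C : ℝ | 0 ≤ C ∧ ∀ s ∈ I, ∀ t ∈ I, ‖f t - f s‖ ≤ C * |t - s| ^ γ}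

/-- A two-parameter function has finite `γ`-Hölder seminorm on `I`. -/
def Holder2On [NormedAddCommGroup E] (γ : ℝ) (I : Set ℝ) (F : ℝ → ℝ → E) : Prop :=
  ∃ C : ℝ, ∀ s ∈ I, ∀ t ∈ I, ‖F s t‖ ≤ C * |t - s| ^ γ

/-- The `γ`-Hölder seminorm of a two-parameter function on `I`. -/
def holder2Norm [NormedAddCommGroup E] (γ : ℝ) (I : Set ℝ) (F : ℝ → ℝ → E) : ℝ :=
  sInf {C : ℝ | 0 ≤ C ∧ ∀ s ∈ I, ∀ t ∈ I, ‖F s t‖ ≤ C * |t - s| ^ γ}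

/-- A delayed `γ`-rough path with delay `r`: a path `X : ℝ → ℝ^d` together with a
Lévy area `XX` and a delayed Lévy area `XXd`, satisfying Chen's identities and
Hölder bounds.  The tensor `a ⊗ b ∈ ℝ^d ⊗ ℝ^d` is represented by the matrix
`fun i j => a i * b j`. -/
structure DelayedRoughPath (d : ℕ) (r γ : ℝ) : Type where
  X : ℝ → Fin d → ℝ
  XX : ℝ → ℝ → Fin d → Fin d → ℝ
  XXd : ℝ → ℝ → Fin d → Fin d → ℝ
  holX : ∀ a b : ℝ, HolderOn γ (Icc a b) X
  contXX : Continuous fun p : ℝ × ℝ => XX p.1 p.2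
  contXXd : Continuous fun p : ℝ × ℝ => XXd p.1 p.2
  chen : ∀ s u t : ℝ, XX s t = XX s u + XX u t + fun i j => (X u i - X s i) * (X t j - X u j)
  chend : ∀ s u t : ℝ,
    XXd s t = XXd s u + XXd u t + fun i j => (X (u - r) i - X (s - r) i) * (X t j - X u j)
  holXX : ∀ a b : ℝ, Holder2On (2 * γ) (Icc a b) XX
  holXXd : ∀ a b : ℝ, Holder2On (2 * γ) (Icc a b) XXd

variable {d : ℕ} {r γ : ℝ}

/-- The rough path "norm" `‖RP‖_{γ;[a,b]}`. -/
def DelayedRoughPath.hnorm (RP : DelayedRoughPath d r γ) (a b : ℝ) : ℝ :=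
  holderNorm γ (Icc a b) RP.X + holderNorm γ (Icc (a - r) (b - r)) RP.X +
    Real.sqrt (holder2Norm (2 * γ) (Icc a b) RP.XX) +
    Real.sqrt (holder2Norm (2 * γ) (Icc a b) RP.XXd)

section Controlled

variable [NormedAddCommGroup E] [NormedSpace ℝ E]

/-- `(m, m')` is a `β`-controlled path based on `X` on `I`: `m'` is `β`-Hölder and the
remainder `m_{s,t} - m'_s X_{s,t}` has finite `2β`-Hölder seminorm. -/
def IsControlled (β : ℝ) (X : ℝ → Fin d → ℝ) (I : Set ℝ)
    (m : ℝ → E) (m' : ℝ → (Fin d → ℝ) →L[ℝ] E) : Prop :=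
  HolderOn β I m' ∧
    ∃ C : ℝ, ∀ s ∈ I, ∀ t ∈ I, ‖m t - m s - m' s (X t - X s)‖ ≤ C * |t - s| ^ (2 * β)

/-- The norm of the controlled path `(m, m')` in `𝒟_X^β([a,b])`. -/
def cpNorm (β : ℝ) (X : ℝ → Fin d → ℝ) (a b : ℝ)
    (m : ℝ → E) (m' : ℝ → (Fin d → ℝ) →L[ℝ] E) : ℝ :=
  ‖m a‖ + ‖m' a‖ + holderNorm β (Icc a b) m' +
    sInf {C : ℝ | 0 ≤ C ∧ ∀ s ∈ Icc a b, ∀ t ∈ Icc a b,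
      ‖m t - m s - m' s (X t - X s)‖ ≤ C * |t - s| ^ (2 * β)}

/-- `(m, ζ0, ζ1)` is a delayed `(α, β, θ)`-controlled path based on `X` on `[a,b]`
(with delay `rr`). -/
def IsDelayedControlled (rr α β θ : ℝ) (X : ℝ → Fin d → ℝ) (a b : ℝ)
    (m : ℝ → E) (ζ0 ζ1 : ℝ → (Fin d → ℝ) →L[ℝ] E) : Prop :=
  HolderOn α (Icc a b) m ∧ HolderOn β (Icc a b) ζ0 ∧ HolderOn β (Icc a b) ζ1 ∧
    ∃ C : ℝ, ∀ s ∈ Icc a b, ∀ t ∈ Icc a b,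
      ‖m t - m s - ζ0 s (X t - X s) - ζ1 s (X (t - rr) - X (s - rr))‖ ≤ C * |t - s| ^ θ

/-- The norm on the space `𝒟_X^{α,β,θ}([a,b])` of delayed controlled paths. -/
def dcpNorm (rr α β θ : ℝ) (X : ℝ → Fin d → ℝ) (a b : ℝ)
    (m : ℝ → E) (ζ0 ζ1 : ℝ → (Fin d → ℝ) →L[ℝ] E) : ℝ :=
  ‖m a‖ + ‖ζ0 a‖ + ‖ζ1 a‖ + holderNorm α (Icc a b) m + holderNorm β (Icc a b) ζ0 +
    holderNorm β (Icc a b) ζ1 +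
    sInf {C : ℝ | 0 ≤ C ∧ ∀ s ∈ Icc a b, ∀ t ∈ Icc a b,
      ‖m t - m s - ζ0 s (X t - X s) - ζ1 s (X (t - rr) - X (s - rr))‖ ≤ C * |t - s| ^ θ}

/-- Application of a bilinear-map-valued coefficient to a tensor (matrix). -/
def apply2 (ζ : (Fin d → ℝ) →L[ℝ] ((Fin d → ℝ) →L[ℝ] E)) (M : Fin d → Fin d → ℝ) : E :=
  ∑ i : Fin d, ∑ j : Fin d, M i j • ζ (Pi.single i 1) (Pi.single j 1)

/-- A partition of the interval `[s,t]`. -/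
structure Partition (s t : ℝ) : Type where
  n : ℕ
  pts : ℕ → ℝ
  h0 : pts 0 = s
  hn : pts n = t
  mono : ∀ i < n, pts i ≤ pts (i + 1)

/-- The mesh of the partition is at most `δ`. -/
def Partition.MeshLE {s t : ℝ} (P : Partition s t) (δ : ℝ) : Prop :=
  ∀ i < P.n, P.pts (i + 1) - P.pts i ≤ δ

/-- The compensated Riemann sum of a delayed controlled integrand along a partition. -/
def riemannSum (RP : DelayedRoughPath d r γ) (m : ℝ → (Fin d → ℝ) →L[ℝ] E)
    (ζ0 ζ1 : ℝ → (Fin d → ℝ) →L[ℝ] ((Fin d → ℝ) →L[ℝ] E)) {s t : ℝ} (P : Partition s t) : E :=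
  ∑ i ∈ Finset.range P.n,
    (m (P.pts i) (RP.X (P.pts (i + 1)) - RP.X (P.pts i)) +
      apply2 (ζ0 (P.pts i)) (RP.XX (P.pts i) (P.pts (i + 1))) +
      apply2 (ζ1 (P.pts i)) (RP.XXd (P.pts i) (P.pts (i + 1))))

/-- `v` is the rough delay integral `∫_s^t m dX` of the delayed controlled path
`(m, ζ0, ζ1)` against `RP`: the compensated Riemann sums converge to `v` as the mesh
tends to zero. -/
def HasRoughIntegral (RP : DelayedRoughPath d r γ) (m : ℝ → (Fin d → ℝ) →L[ℝ] E)
    (ζ0 ζ1 : ℝ → (Fin d → ℝ) →L[ℝ] ((Fin d → ℝ) →L[ℝ] E)) (s t : ℝ) (v : E) : Prop :=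
  ∀ ε > (0:ℝ), ∃ δ > (0:ℝ), ∀ P : Partition s t, P.MeshLE δ → ‖riemannSum RP m ζ0 ζ1 P - v‖ ≤ ε

/-- Compensated Riemann sum for the (non-delayed) forward rough integral. -/
def riemannSumFwd (X : ℝ → Fin d → ℝ) (XX : ℝ → ℝ → Fin d → Fin d → ℝ)
    (m : ℝ → (Fin d → ℝ) →L[ℝ] E) (m' : ℝ → (Fin d → ℝ) →L[ℝ] ((Fin d → ℝ) →L[ℝ] E))
    {s t : ℝ} (P : Partition s t) : E :=
  ∑ i ∈ Finset.range P.n,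
    (m (P.pts i) (X (P.pts (i + 1)) - X (P.pts i)) +
      apply2 (m' (P.pts i)) (XX (P.pts i) (P.pts (i + 1))))

/-- The forward rough integral of a controlled path, via left-point compensated sums. -/
def HasFwdIntegral (X : ℝ → Fin d → ℝ) (XX : ℝ → ℝ → Fin d → Fin d → ℝ)
    (m : ℝ → (Fin d → ℝ) →L[ℝ] E) (m' : ℝ → (Fin d → ℝ) →L[ℝ] ((Fin d → ℝ) →L[ℝ] E))
    (s t : ℝ) (v : E) : Prop :=
  ∀ ε > (0:ℝ), ∃ δ > (0:ℝ), ∀ P : Partition s t, P.MeshLE δ →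
    ‖riemannSumFwd X XX m m' P - v‖ ≤ ε

/-- Compensated Riemann sum for the backward rough integral (right endpoints). -/
def riemannSumBwd (X : ℝ → Fin d → ℝ) (XX : ℝ → ℝ → Fin d → Fin d → ℝ)
    (m : ℝ → (Fin d → ℝ) →L[ℝ] E) (m' : ℝ → (Fin d → ℝ) →L[ℝ] ((Fin d → ℝ) →L[ℝ] E))
    {s t : ℝ} (P : Partition s t) : E :=
  ∑ i ∈ Finset.range P.n,
    (m (P.pts (i + 1)) (X (P.pts (i + 1)) - X (P.pts i)) +
      apply2 (m' (P.pts (i + 1))) (XX (P.pts i) (P.pts (i + 1))))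

/-- The backward rough integral, via right-point compensated sums. -/
def HasBwdIntegral (X : ℝ → Fin d → ℝ) (XX : ℝ → ℝ → Fin d → Fin d → ℝ)
    (m : ℝ → (Fin d → ℝ) →L[ℝ] E) (m' : ℝ → (Fin d → ℝ) →L[ℝ] ((Fin d → ℝ) →L[ℝ] E))
    (s t : ℝ) (v : E) : Prop :=
  ∀ ε > (0:ℝ), ∃ δ > (0:ℝ), ∀ P : Partition s t, P.MeshLE δ →
    ‖riemannSumBwd X XX m m' P - v‖ ≤ ε

end Controlled

section Smooth

variable [NormedAddCommGroup E₁] [NormedSpace ℝ E₁] [NormedAddCommGroup E₂] [NormedSpace ℝ E₂]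

/-- `f ∈ C^n_b`: `f` is `n` times continuously differentiable with bounded derivatives
(up to order `n`). -/
def CnBounded (n : ℕ) (f : E₁ → E₂) : Prop :=
  ContDiff ℝ n f ∧ ∀ i : ℕ, i ≤ n → ∃ C : ℝ, ∀ x, ‖iteratedFDeriv ℝ i f x‖ ≤ C

/-- `f ∈ 𝒞^{m+κ}`: derivatives up to order `m` are bounded and continuous and the
`m`-th derivative is `κ`-Hölder. -/
def CHolderClass (m : ℕ) (κ : ℝ) (f : E₁ → E₂) : Prop :=
  ContDiff ℝ m f ∧ (∀ i : ℕ, i ≤ m → ∃ C : ℝ, ∀ x, ‖iteratedFDeriv ℝ i f x‖ ≤ C) ∧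
    ∃ C : ℝ, ∀ x y, ‖iteratedFDeriv ℝ m f x - iteratedFDeriv ℝ m f y‖ ≤ C * ‖x - y‖ ^ κ

end Smooth

section CNdelta

variable {F₁ F₂ : Type*} [AddCommGroup F₁] [Module ℝ F₁] [AddCommGroup F₂] [Module ℝ F₂]

/-- A map `F` between (semi-)normed spaces (seminorms `N₁`, `N₂`) is of class `𝒞^{n+δ}`
on `U`: there exist multilinear derivative maps `D j`, `j ≤ n`, bounded with respect
to the seminorms, where `D (j+1)` is the Fréchet derivative of `D j` on `U` and `D n`
is `δ`-Hölder on `U`. -/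
def IsCNdeltaOn (N₁ : F₁ → ℝ) (N₂ : F₂ → ℝ) (F : F₁ → F₂) (U : Set F₁) (n : ℕ) (δ : ℝ) :
    Prop :=
  ∃ D : (j : ℕ) → F₁ → ((Fin j → F₁) → F₂),
    (∀ x ∈ U, ∀ v : Fin 0 → F₁, D 0 x v = F x) ∧
    (∀ j : ℕ, j ≤ n → ∀ x ∈ U, ∀ (v : Fin j → F₁) (i : Fin j) (a b : F₁) (c : ℝ),
      D j x (Function.update v i (a + b)) =
          D j x (Function.update v i a) + D j x (Function.update v i b) ∧
        D j x (Function.update v i (c • a)) = c • D j x (Function.update v i a)) ∧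
    (∀ j : ℕ, j ≤ n → ∀ x ∈ U, ∃ C : ℝ, ∀ v : Fin j → F₁,
      N₂ (D j x v) ≤ C * ∏ i : Fin j, N₁ (v i)) ∧
    (∀ j : ℕ, j < n → ∀ x ∈ U, ∀ ε > (0:ℝ), ∃ ρ > (0:ℝ), ∀ h : F₁, N₁ h ≤ ρ → x + h ∈ U →
      ∀ v : Fin j → F₁,
        N₂ (D j (x + h) v - D j x v - D (j + 1) x (Fin.cons h v)) ≤
          ε * N₁ h * ∏ i : Fin j, N₁ (v i)) ∧
    ∃ C : ℝ, ∀ x ∈ U, ∀ y ∈ U, ∀ v : Fin n → F₁,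
      N₂ (D n x v - D n y v) ≤ C * N₁ (x - y) ^ δ * ∏ i : Fin n, N₁ (v i)

/-- `F` is locally of class `𝒞^{n+δ}` on `S`. -/
def IsLocallyCNdeltaOn (N₁ : F₁ → ℝ) (N₂ : F₂ → ℝ) (F : F₁ → F₂) (S : Set F₁) (n : ℕ)
    (δ : ℝ) : Prop :=
  ∀ x ∈ S, ∃ ρ > (0:ℝ), IsCNdeltaOn N₁ N₂ F (S ∩ {y | N₁ (y - x) < ρ}) n δ

end CNdelta

section Equation

variable {W : Type*} [NormedAddCommGroup W] [NormedSpace ℝ W]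

/-- The partial derivative `σ_x` of `σ` in the first variable. -/
def sigmaX (σ : W × W → (Fin d → ℝ) →L[ℝ] W) : W × W → W →L[ℝ] ((Fin d → ℝ) →L[ℝ] W) :=
  fun p => (fderiv ℝ σ p).comp (ContinuousLinearMap.inl ℝ W W)

/-- The partial derivative `σ_y` of `σ` in the second variable. -/
def sigmaY (σ : W × W → (Fin d → ℝ) →L[ℝ] W) : W × W → W →L[ℝ] ((Fin d → ℝ) →L[ℝ] W) :=
  fun p => (fderiv ℝ σ p).comp (ContinuousLinearMap.inr ℝ W W)

/-- The Gubinelli derivative of a solution: `ξ'` on `[-r,0)`, `σ(y_t, y_{t-r})` for `t ≥ 0`. -/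
def solDeriv (σ : W × W → (Fin d → ℝ) →L[ℝ] W) (rr : ℝ)
    (ξ' : ℝ → (Fin d → ℝ) →L[ℝ] W) (y : ℝ → W) : ℝ → (Fin d → ℝ) →L[ℝ] W :=
  fun t => if t < 0 then ξ' t else σ (y t, y (t - rr))

/-- `ζ⁰` component of the integrand `τ ↦ σ(y_τ, y_{τ-r})`:  `σ_x(y_τ, y_{τ-r}) y'_τ`. -/
def zeta0 (σ : W × W → (Fin d → ℝ) →L[ℝ] W) (rr : ℝ) (y : ℝ → W)
    (y' : ℝ → (Fin d → ℝ) →L[ℝ] W) : ℝ → (Fin d → ℝ) →L[ℝ] ((Fin d → ℝ) →L[ℝ] W) :=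
  fun τ => (sigmaX σ (y τ, y (τ - rr))).comp (y' τ)

/-- `ζ¹` component of the integrand `τ ↦ σ(y_τ, y_{τ-r})`:  `σ_y(y_τ, y_{τ-r}) y'_{τ-r}`. -/
def zeta1 (σ : W × W → (Fin d → ℝ) →L[ℝ] W) (rr : ℝ) (y : ℝ → W)
    (y' : ℝ → (Fin d → ℝ) →L[ℝ] W) : ℝ → (Fin d → ℝ) →L[ℝ] ((Fin d → ℝ) →L[ℝ] W) :=
  fun τ => (sigmaY σ (y τ, y (τ - rr))).comp (y' (τ - rr))

/-- `y` solves `dy_t = B(y_t, y_{t-r}) dt + σ(y_t, y_{t-r}) dRP_t` on `[0,T]` with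
initial condition `(ξ, ξ')` on `[-r,0]`:  `y = ξ` on `[-r,0]`, on each interval
`[kr, (k+1)r] ∩ [0,T]` the path is `β`-controlled with Gubinelli derivative
`y'_t = σ(y_t, y_{t-r})`, and the integral identity holds for `0 ≤ s ≤ t ≤ T`. -/
def IsSolOnT (RP : DelayedRoughPath d r γ) (σ : W × W → (Fin d → ℝ) →L[ℝ] W)
    (B : W × W →ₗ[ℝ] W) (β : ℝ) (ξ : ℝ → W) (ξ' : ℝ → (Fin d → ℝ) →L[ℝ] W)
    (T : ℝ) (y : ℝ → W) : Prop :=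
  (∀ t ∈ Icc (-r) 0, y t = ξ t) ∧
    (∀ k : ℕ, (k : ℝ) * r ≤ T →
      IsControlled β RP.X (Icc ((k : ℝ) * r) (min (((k : ℝ) + 1) * r) T)) y
        (solDeriv σ r ξ' y)) ∧
    ∀ s t : ℝ, 0 ≤ s → s ≤ t → t ≤ T →
      HasRoughIntegral RP (fun τ => σ (y τ, y (τ - r)))
        (zeta0 σ r y (solDeriv σ r ξ' y)) (zeta1 σ r y (solDeriv σ r ξ' y)) s t
        (y t - y s - ∫ τ in s..t, B (y τ, y (τ - r)))

/-- `y` solves `dy_t = B(y_t, y_{t-r}) dt + σ(y_t, y_{t-r}) dRP_t` on `[0,r]` with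
initial condition `(ξ, ξ')` on `[-r,0]`. -/
def IsSolOn (RP : DelayedRoughPath d r γ) (σ : W × W → (Fin d → ℝ) →L[ℝ] W)
    (B : W × W →ₗ[ℝ] W) (β : ℝ) (ξ : ℝ → W) (ξ' : ℝ → (Fin d → ℝ) →L[ℝ] W)
    (y : ℝ → W) : Prop :=
  (∀ t ∈ Icc (-r) 0, y t = ξ t) ∧
    IsControlled β RP.X (Icc 0 r) y (solDeriv σ r ξ' y) ∧
    ∀ t ∈ Icc 0 r,
      HasRoughIntegral RP (fun τ => σ (y τ, y (τ - r)))
        (zeta0 σ r y (solDeriv σ r ξ' y)) (zeta1 σ r y (solDeriv σ r ξ' y)) 0 t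
        (y t - ξ 0 - ∫ τ in (0:ℝ)..t, B (y τ, y (τ - r)))

/-- The solution map `ξ ↦ y^ξ` on pairs (path, Gubinelli derivative). -/
def solMap (RP : DelayedRoughPath d r γ) (σ : W × W → (Fin d → ℝ) →L[ℝ] W)
    (B : W × W →ₗ[ℝ] W) (β : ℝ) :
    ((ℝ → W) × (ℝ → (Fin d → ℝ) →L[ℝ] W)) → ((ℝ → W) × (ℝ → (Fin d → ℝ) →L[ℝ] W)) :=
  fun p =>
    @dite _ (∃ y : ℝ → W, IsSolOn RP σ B β p.1 p.2 y) (Classical.dec _)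
      (fun h => (h.choose, solDeriv σ r p.2 h.choose)) (fun _ => 0)

/-- `D` is the Fréchet derivative of the solution map at the controlled path `p`:
`D` is a bounded linear map (w.r.t. the controlled path norms) and
`‖solMap (p+h) - solMap p - D h‖ = o(‖h‖)` on controlled directions `h`. -/
def IsSolMapDerivAt (RP : DelayedRoughPath d r γ) (σ : W × W → (Fin d → ℝ) →L[ℝ] W)
    (B : W × W →ₗ[ℝ] W) (β : ℝ) (p : (ℝ → W) × (ℝ → (Fin d → ℝ) →L[ℝ] W))
    (D : ((ℝ → W) × (ℝ → (Fin d → ℝ) →L[ℝ] W)) →ₗ[ℝ]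
      ((ℝ → W) × (ℝ → (Fin d → ℝ) →L[ℝ] W))) : Prop :=
  (∃ C : ℝ, 0 ≤ C ∧ ∀ q : (ℝ → W) × (ℝ → (Fin d → ℝ) →L[ℝ] W),
    IsControlled β RP.X (Icc (-r) 0) q.1 q.2 →
      cpNorm β RP.X 0 r (D q).1 (D q).2 ≤ C * cpNorm β RP.X (-r) 0 q.1 q.2) ∧
    ∀ ε > (0:ℝ), ∃ δ > (0:ℝ), ∀ h : (ℝ → W) × (ℝ → (Fin d → ℝ) →L[ℝ] W),
      IsControlled β RP.X (Icc (-r) 0) h.1 h.2 → cpNorm β RP.X (-r) 0 h.1 h.2 ≤ δ →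
        cpNorm β RP.X 0 r (solMap RP σ B β (p + h) - solMap RP σ B β p - D h).1
            (solMap RP σ B β (p + h) - solMap RP σ B β p - D h).2 ≤
          ε * cpNorm β RP.X (-r) 0 h.1 h.2

/-- The map `(a,b,c,e) ↦ σ_x(a,b) c + σ_y(a,b) e` appearing in the linearized equation. -/
def PhiLin (σ : W × W → (Fin d → ℝ) →L[ℝ] W) : W × W × W × W → (Fin d → ℝ) →L[ℝ] W :=
  fun p => sigmaX σ (p.1, p.2.1) p.2.2.1 + sigmaY σ (p.1, p.2.1) p.2.2.2

/-- The integrand `τ ↦ σ_x(y_τ, ξ_{τ-r}) Z_τ + σ_y(y_τ, ξ_{τ-r}) η_{τ-r}` of the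
linearized equation. -/
def linInt (σ : W × W → (Fin d → ℝ) →L[ℝ] W) (rr : ℝ) (ξ y Z ηf : ℝ → W) :
    ℝ → (Fin d → ℝ) →L[ℝ] W :=
  fun τ => sigmaX σ (y τ, ξ (τ - rr)) (Z τ) + sigmaY σ (y τ, ξ (τ - rr)) (ηf (τ - rr))

/-- The `ζ⁰` component of the linearized integrand, via the Leibniz rule. -/
def zeta0lin (σ : W × W → (Fin d → ℝ) →L[ℝ] W) (rr : ℝ) (ξ y Z ηf : ℝ → W)
    (y' Z' : ℝ → (Fin d → ℝ) →L[ℝ] W) : ℝ → (Fin d → ℝ) →L[ℝ] ((Fin d → ℝ) →L[ℝ] W) :=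
  fun τ => (fderiv ℝ (PhiLin σ) (y τ, ξ (τ - rr), Z τ, ηf (τ - rr))).comp
    ((y' τ).prod (((0 : (Fin d → ℝ) →L[ℝ] W)).prod ((Z' τ).prod (0 : (Fin d → ℝ) →L[ℝ] W))))

/-- The `ζ¹` component of the linearized integrand, via the Leibniz rule. -/
def zeta1lin (σ : W × W → (Fin d → ℝ) →L[ℝ] W) (rr : ℝ) (ξ y Z ηf : ℝ → W)
    (ξ' η' : ℝ → (Fin d → ℝ) →L[ℝ] W) : ℝ → (Fin d → ℝ) →L[ℝ] ((Fin d → ℝ) →L[ℝ] W) :=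
  fun τ => (fderiv ℝ (PhiLin σ) (y τ, ξ (τ - rr), Z τ, ηf (τ - rr))).comp
    (((0 : (Fin d → ℝ) →L[ℝ] W)).prod
      ((ξ' (τ - rr)).prod (((0 : (Fin d → ℝ) →L[ℝ] W)).prod (η' (τ - rr)))))

/-- `Z` solves the linearized rough delay equation along `y = y^ξ` in the direction
`(η, η')`, i.e. `Z_t = η_0 + ∫_0^t B(Z_τ, η_{τ-r}) dτ
 + ∫_0^t [σ_x(y_τ, ξ_{τ-r}) Z_τ + σ_y(y_τ, ξ_{τ-r}) η_{τ-r}] dRP_τ` on `[0,r]`,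
`Z = η` on `[-r,0]`, with the Gubinelli derivative given by the integrand. -/
def IsLinSolOn (RP : DelayedRoughPath d r γ) (σ : W × W → (Fin d → ℝ) →L[ℝ] W)
    (B : W × W →ₗ[ℝ] W) (β : ℝ) (ξ ηf : ℝ → W) (ξ' η' : ℝ → (Fin d → ℝ) →L[ℝ] W)
    (y : ℝ → W) (Z : ℝ → W) : Prop :=
  (∀ t ∈ Icc (-r) 0, Z t = ηf t) ∧
    IsControlled β RP.X (Icc 0 r) Z
      (fun τ => if τ < 0 then η' τ else linInt σ r ξ y Z ηf τ) ∧
    ∀ t ∈ Icc 0 r,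
      HasRoughIntegral RP (linInt σ r ξ y Z ηf)
        (zeta0lin σ r ξ y Z ηf (solDeriv σ r ξ' y)
          (fun τ => if τ < 0 then η' τ else linInt σ r ξ y Z ηf τ))
        (zeta1lin σ r ξ y Z ηf ξ' η') 0 t
        (Z t - ηf 0 - ∫ τ in (0:ℝ)..t, B (Z τ, ηf (τ - r)))

/-- `y` solves the frozen-delay equation `y_t = x + ∫_s^t σ(y_τ, ξ_{τ-r}) dRP_τ` on `[s,r]`
with Gubinelli derivative `σ(y_·, ξ_{·-r})`. -/
def IsFrozenSol (RP : DelayedRoughPath d r γ) (σ : W × W → (Fin d → ℝ) →L[ℝ] W) (β : ℝ)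
    (ξ : ℝ → W) (ξ' : ℝ → (Fin d → ℝ) →L[ℝ] W) (s : ℝ) (x : W) (y : ℝ → W) : Prop :=
  y s = x ∧
    IsControlled β RP.X (Icc s r) y (fun τ => σ (y τ, ξ (τ - r))) ∧
    ∀ t ∈ Icc s r,
      HasRoughIntegral RP (fun τ => σ (y τ, ξ (τ - r)))
        (fun τ => (sigmaX σ (y τ, ξ (τ - r))).comp (σ (y τ, ξ (τ - r))))
        (fun τ => (sigmaY σ (y τ, ξ (τ - r))).comp (ξ' (τ - r))) s t (y t - x)

/-- The solution flow `φ̄(s, ·, x)` of the frozen-delay equation. -/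
def frozenFlow (RP : DelayedRoughPath d r γ) (σ : W × W → (Fin d → ℝ) →L[ℝ] W) (β : ℝ)
    (ξ : ℝ → W) (ξ' : ℝ → (Fin d → ℝ) →L[ℝ] W) (s : ℝ) (x : W) : ℝ → W :=
  @dite _ (∃ y : ℝ → W, IsFrozenSol RP σ β ξ ξ' s x y) (Classical.dec _)
    (fun h => h.choose) (fun _ => fun _ => x)

end Equation

end SDDE

namespace SDDE

open Set Filter Topology

set_option linter.unusedSectionVars false

section AlmostFlow

variable {W : Type*} [NormedAddCommGroup W] [NormedSpace ℝ W]

/-- Almost flow `x ↦ x + A u v x`. -/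
structure AF (A : ℝ → ℝ → W → W) (r β C : ℝ) : Prop where
  hC : 0 ≤ C
  hr : 0 < r
  hβ : 1 / 3 < β
  bd : ∀ u v, 0 ≤ u → u ≤ v → v ≤ r → ∀ x, ‖A u v x‖ ≤ C * (v - u) ^ β
  lip : ∀ u v, 0 ≤ u → u ≤ v → v ≤ r → ∀ x x', ‖A u v x - A u v x'‖ ≤ C * (v - u) ^ β * ‖x - x'‖
  four : ∀ u v, 0 ≤ u → u ≤ v → v ≤ r → ∀ a b h k,
    ‖A u v (a + h) - A u v a - (A u v (b + k) - A u v b)‖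
      ≤ C * (v - u) ^ β * (‖h - k‖ + ‖a - b‖ * ‖k‖)
  dbd : ∀ u w v, 0 ≤ u → u ≤ w → w ≤ v → v ≤ r → ∀ x,
    ‖A w v (x + A u w x) + A u w x - A u v x‖ ≤ C * (v - u) ^ (3 * β)
  dlip : ∀ u w v, 0 ≤ u → u ≤ w → w ≤ v → v ≤ r → ∀ x x',
    ‖(A w v (x + A u w x) + A u w x - A u v x) - (A w v (x' + A u w x') + A u w x' - A u v x')‖
      ≤ C * (v - u) ^ (3 * β) * ‖x - x'‖

/-- Davie-type solutions. -/
def Davie (A : ℝ → ℝ → W → W) (r β s K : ℝ) (y : ℝ → W) : Prop :=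
  ∀ u v, s ≤ u → u ≤ v → v ≤ r → ‖y v - y u - A u v (y u)‖ ≤ K * (v - u) ^ (3 * β)

theorem exists_small (C ε p : ℝ) (hC : 0 ≤ C) (hε : 0 < ε) (hp : 0 < p) :
    ∃ h > (0:ℝ), ∀ t, 0 ≤ t → t ≤ h → C * t ^ p ≤ ε := by
  refine ⟨(ε / (C + 1)) ^ (1 / p), by positivity, fun t ht hth => ?_⟩
  have h1 : t ^ p ≤ ε / (C + 1) := by
    calc t ^ p ≤ ((ε / (C + 1)) ^ (1 / p)) ^ p := Real.rpow_le_rpow ht hth hp.le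
      _ = ε / (C + 1) := by
        rw [← Real.rpow_mul (by positivity), one_div_mul_cancel hp.ne', Real.rpow_one]
  calc C * t ^ p ≤ C * (ε / (C + 1)) := by gcongr
    _ = ε * (C / (C + 1)) := by ring
    _ ≤ ε * 1 := by
      gcongr
      rw [div_le_one (by positivity)]; linarith
    _ = ε := mul_one _

theorem half_rpow_lt {θ : ℝ} (hθ : 1 < θ) : (1 / 2 : ℝ) ^ θ < 1 / 2 := by
  have := Real.rpow_lt_rpow_of_exponent_gt (x := (1 / 2 : ℝ)) (by norm_num) (by norm_num) hθ
  simpa using this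

theorem half_len_rpow {θ l m : ℝ} (hθ : 0 < θ) (hm : 0 ≤ m) (hml : m ≤ l / 2) :
    m ^ θ ≤ (1 / 2 : ℝ) ^ θ * l ^ θ := by
  have hl : 0 ≤ l := by linarith
  calc m ^ θ ≤ (1 / 2 * l) ^ θ := Real.rpow_le_rpow hm (by linarith) hθ.le
    _ = _ := Real.mul_rpow (by norm_num) hl

variable {A : ℝ → ℝ → W → W} {r β C : ℝ}

theorem AF.disc (hA : AF A r β C) {h K : ℝ} (hK : 0 ≤ K)
    (hh : ∀ t, 0 ≤ t → t ≤ h → C * t ^ β ≤ 1 - 2 * (1 / 2 : ℝ) ^ (3 * β))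
    (hKC : (2 + (1 - 2 * (1 / 2 : ℝ) ^ (3 * β))) * (1 / 2 : ℝ) ^ (3 * β) * K + 2 * C ≤ K)
    (P : Finset ℝ) (hP : ∀ p ∈ P, 0 ≤ p ∧ p ≤ r) (y : ℝ → W)
    (good : ∀ u ∈ P, ∀ v ∈ P, u < v → (∀ w ∈ P, ¬ (u < w ∧ w < v)) → y v = y u + A u v (y u)) :
    ∀ n : ℕ, ∀ u ∈ P, ∀ v ∈ P, (P.filter (fun p => u ≤ p ∧ p ≤ v)).card ≤ n → u ≤ v → v - u ≤ h →
      ‖y v - y u - A u v (y u)‖ ≤ K * (v - u) ^ (3 * β) := by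
  have hβ := hA.hβ
  have hC := hA.hC
  intro n
  induction n with
  | zero =>
    intro u hu v hv hc huv
    have : u ∈ P.filter (fun p => u ≤ p ∧ p ≤ v) := by simp [hu, huv]
    rw [Finset.card_eq_zero.1 (Nat.le_zero.1 hc)] at this
    simp at this
  | succ n ih =>
    intro u hu v hv hc huv hvh
    rcases huv.eq_or_lt with rfl | huv'
    · have := hA.bd u u (hP u hu).1 le_rfl (hP u hu).2 (y u)
      rw [sub_self, Real.zero_rpow (by linarith), mul_zero] at this
      rw [sub_self, zero_sub, norm_neg, sub_self, Real.zero_rpow (by linarith), mul_zero]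
      exact this
    obtain ⟨a, ha, hamax⟩ := Finset.exists_max_image
      (P.filter (fun p => u ≤ p ∧ p ≤ (u + v) / 2)) id ⟨u, by simp [hu]; linarith⟩
    obtain ⟨b, hb, hbmin⟩ := Finset.exists_min_image
      (P.filter (fun p => (u + v) / 2 < p ∧ p ≤ v)) id ⟨v, by simp [hv]; linarith⟩
    simp only [Finset.mem_filter, id] at ha hb hamax hbmin
    obtain ⟨haP, hua, ham⟩ := ha
    obtain ⟨hbP, hmb, hbv⟩ := hb
    have hab : a < b := by linarith
    have hyb : y b = y a + A a b (y a) := by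
      refine good a haP b hbP hab ?_
      rintro w hw ⟨h1, h2⟩
      rcases le_or_gt w ((u + v) / 2) with h3 | h3
      · have := hamax w ⟨hw, by linarith, h3⟩; linarith
      · have := hbmin w ⟨hw, h3, by linarith⟩; linarith
    have h1 := ih u hu a haP (by
      have : (P.filter (fun p => u ≤ p ∧ p ≤ a)).card < (P.filter (fun p => u ≤ p ∧ p ≤ v)).card := by
        apply Finset.card_lt_card
        refine ⟨fun p hp => ?_, fun hs => ?_⟩
        · simp only [Finset.mem_filter] at hp ⊢
          exact ⟨hp.1, hp.2.1, by linarith⟩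
        · have := hs (show v ∈ _ by simp [hv, huv])
          simp only [Finset.mem_filter] at this
          linarith
      omega) hua (by linarith)
    have h2 := ih b hbP v hv (by
      have : (P.filter (fun p => b ≤ p ∧ p ≤ v)).card < (P.filter (fun p => u ≤ p ∧ p ≤ v)).card := by
        apply Finset.card_lt_card
        refine ⟨fun p hp => ?_, fun hs => ?_⟩
        · simp only [Finset.mem_filter] at hp ⊢
          exact ⟨hp.1, by linarith, by linarith⟩
        · have := hs (show u ∈ _ by simp [hu, huv])
          simp only [Finset.mem_filter] at this
          linarith
      omega) hbv (by linarith)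
    have h0u := (hP u hu).1
    have hvr := (hP v hv).2
    have h3 := hA.dbd a b v (by linarith) hab.le hbv hvr (y a)
    have h4 := hA.dbd u a v h0u hua (by linarith) hvr (y u)
    have h5 := hA.lip a v (by linarith) (by linarith) hvr (y a) (y u + A u a (y u))
    have h6 := hh (v - a) (by linarith) (by linarith)
    rw [← hyb] at h3
    have e : y v - y u - A u v (y u) = (y v - y b - A b v (y b)) +
        (A b v (y b) + A a b (y a) - A a v (y a)) +
        (A a v (y a) - A a v (y u + A u a (y u))) +
        (A a v (y u + A u a (y u)) + A u a (y u) - A u v (y u)) +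
        (y a - y u - A u a (y u)) := by
      rw [hyb]; abel
    have e2 : y a - (y u + A u a (y u)) = y a - y u - A u a (y u) := by abel
    rw [e2] at h5
    have ha' := half_len_rpow (θ := 3 * β) (l := v - u) (m := a - u) (by linarith) (by linarith) (by linarith)
    have hb' := half_len_rpow (θ := 3 * β) (l := v - u) (m := v - b) (by linarith) (by linarith) (by linarith)
    have hc' : (v - a) ^ (3 * β) ≤ (v - u) ^ (3 * β) :=
      Real.rpow_le_rpow (by linarith) (by linarith) (by linarith)
    set q : ℝ := (1 / 2 : ℝ) ^ (3 * β) with hq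
    have hq0 : 0 ≤ q := by positivity
    have hq1 : q < 1 / 2 := half_rpow_lt (by linarith)
    have hl0 : 0 ≤ (v - u) ^ (3 * β) := Real.rpow_nonneg (by linarith) _
    set T := (v - u) ^ (3 * β)
    have hR : ‖y a - y u - A u a (y u)‖ ≤ K * (q * T) := h1.trans (by gcongr)
    calc ‖y v - y u - A u v (y u)‖ ≤ K * (q * T) + C * T + (1 - 2 * q) * (K * (q * T)) + C * T
          + K * (q * T) := by
          rw [e]
          refine norm_add_le_of_le (norm_add_le_of_le (norm_add_le_of_le (norm_add_le_of_le
            ?_ ?_) ?_) ?_) hR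
          · exact h2.trans (by gcongr)
          · exact h3.trans (by gcongr)
          · refine h5.trans ?_
            exact mul_le_mul h6 hR (norm_nonneg _) (by linarith)
          · exact h4
      _ = ((2 + (1 - 2 * q)) * q * K + 2 * C) * T := by ring
      _ ≤ K * T := by gcongr

theorem exists_good (A : ℝ → ℝ → W → W) (s : ℝ) (x : W) (P : Finset ℝ) :
    (∀ p ∈ P, s < p) → ∃ y : ℝ → W, y s = x ∧ ∀ u ∈ insert s P, ∀ v ∈ insert s P, u < v →
      (∀ w ∈ insert s P, ¬ (u < w ∧ w < v)) → y v = y u + A u v (y u) := by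
  induction P using Finset.induction_on_max with
  | empty =>
    intro _
    refine ⟨fun _ => x, rfl, ?_⟩
    intro u hu v hv huv
    simp at hu hv
    linarith
  | insert a P hmax ih =>
    intro hP
    obtain ⟨y, hy, good⟩ := ih (fun p hp => hP p (Finset.mem_insert_of_mem hp))
    have hsa : s < a := hP a (Finset.mem_insert_self _ _)
    obtain ⟨b, hb, hbmax⟩ := Finset.exists_max_image (insert s P) id ⟨s, by simp⟩
    have hlt : ∀ p ∈ insert s P, p < a := by
      intro p hp
      rcases Finset.mem_insert.1 hp with rfl | hp
      · exact hsa
      · exact hmax p hp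
    have hins : insert s (insert a P) = insert a (insert s P) := Finset.insert_comm _ _ _
    refine ⟨Function.update y a (y b + A b a (y b)), by simp [hsa.ne, hy], ?_⟩
    rw [hins]
    intro u hu v hv huv hw
    rcases Finset.mem_insert.1 hv with rfl | hv
    · rcases Finset.mem_insert.1 hu with rfl | hu
      · exact absurd huv (lt_irrefl _)
      have : u = b := by
        have h1 := hbmax u hu
        simp only [id] at h1
        rcases h1.eq_or_lt with h | h
        · exact h
        · exact absurd ⟨h, hlt b hb⟩ (hw b (Finset.mem_insert_of_mem hb))
      subst this
      simp [huv.ne]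
    · have hva := hlt v hv
      rcases Finset.mem_insert.1 hu with rfl | hu
      · exact absurd huv (by linarith)
      rw [Function.update_of_ne hva.ne, Function.update_of_ne (hlt u hu).ne]
      exact good u hu v hv huv (fun w h => hw w (Finset.mem_insert_of_mem h))

theorem AF.exists_davie [FiniteDimensional ℝ W] (hA : AF A r β C) {s : ℝ} (hs : 0 ≤ s)
    (x : W) : ∃ y : ℝ → W, y s = x ∧ ∃ K, 0 ≤ K ∧ Davie A r β s K y := by
  have hβ := hA.hβ
  have hC := hA.hC
  have hr := hA.hr
  have hq1 : (1 / 2 : ℝ) ^ (3 * β) < 1 / 2 := half_rpow_lt (by linarith)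
  have hq0 : 0 ≤ (1 / 2 : ℝ) ^ (3 * β) := by positivity
  obtain ⟨h, hh0, hh⟩ := exists_small C (1 - 2 * (1 / 2 : ℝ) ^ (3 * β)) β hC (by linarith)
    (by linarith)
  obtain ⟨K, hK, hKC⟩ : ∃ K : ℝ, 0 ≤ K ∧
      (2 + (1 - 2 * (1 / 2 : ℝ) ^ (3 * β))) * (1 / 2 : ℝ) ^ (3 * β) * K + 2 * C ≤ K := by
    set q : ℝ := (1 / 2 : ℝ) ^ (3 * β)
    have h1 : 0 < (1 - 2 * q) * (1 - q) := mul_pos (by linarith) (by linarith)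
    refine ⟨2 * C / ((1 - 2 * q) * (1 - q)), by positivity, le_of_eq ?_⟩
    have h2 : 2 * C / ((1 - 2 * q) * (1 - q)) * ((1 - 2 * q) * (1 - q)) = 2 * C :=
      div_mul_cancel₀ _ h1.ne'
    linear_combination -h2
  choose Y hYs hYg using fun P : Finset ℝ => exists_good A s x (P.filter (fun p => s < p ∧ p ≤ r))
    (fun p hp => (Finset.mem_filter.1 hp).2.1)
  have hmem : ∀ P : Finset ℝ, ∀ t ∈ P, s ≤ t → t ≤ r →
      t ∈ insert s (P.filter (fun p => s < p ∧ p ≤ r)) := by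
    intro P t ht hst htr
    rcases hst.eq_or_lt with rfl | hst
    · simp
    · simp [ht, hst, htr]
  have hYd : ∀ P : Finset ℝ, ∀ u ∈ P, ∀ v ∈ P, s ≤ u → u ≤ v → v ≤ r → v - u ≤ h →
      ‖Y P v - Y P u - A u v (Y P u)‖ ≤ K * (v - u) ^ (3 * β) := by
    intro P u hu v hv hsu huv hvr huh
    refine hA.disc hK hh hKC (insert s (P.filter (fun p => s < p ∧ p ≤ r))) ?_ (Y P) (hYg P)
      _ u (hmem P u hu hsu (huv.trans hvr)) v (hmem P v hv (hsu.trans huv) hvr) le_rfl huv huh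
    intro p hp
    rcases Finset.mem_insert.1 hp with rfl | hp
    · exact ⟨hs, by linarith⟩
    · have := (Finset.mem_filter.1 hp).2
      exact ⟨by linarith, this.2⟩
  set M : ℝ := C * h ^ β + K * h ^ (3 * β) with hM
  have hM0 : 0 ≤ M := by positivity
  obtain ⟨N, hN⟩ := exists_nat_ge (r / h)
  have hN' : r ≤ N * h := by rwa [div_le_iff₀ hh0] at hN
  set G : Finset ℝ := (Finset.range (N + 1)).image (fun k : ℕ => s + k * h) with hG
  have hbound : ∀ P : Finset ℝ, G ⊆ P → ∀ k : ℕ, k ≤ N → ∀ t ∈ P, s ≤ t → t ≤ r → t ≤ s + k * h →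
      ‖Y P t - x‖ ≤ k * M := by
    intro P hGP k
    induction k with
    | zero =>
      intro _ t _ h1 _ h3
      have : t = s := by
        push_cast at h3
        linarith
      subst this
      simp [hYs]
    | succ k ih =>
      intro hk t ht h1 h2 h3
      push_cast at h3 ⊢
      rcases le_or_gt t (s + k * h) with h4 | h4
      · have := ih (by omega) t ht h1 h2 h4
        linarith
      · have hg : s + k * h ∈ P := hGP (by
          rw [hG]; exact Finset.mem_image.2 ⟨k, by simp; omega, rfl⟩)
        have hk0 : (0:ℝ) ≤ k * h := by positivity
        have h5 := ih (by omega) (s + k * h) hg (by linarith) (by linarith) le_rfl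
        have h6 := hYd P (s + k * h) hg t ht (by linarith) h4.le h2 (by linarith)
        have h7 := hA.bd (s + k * h) t (by linarith) h4.le h2 (Y P (s + k * h))
        have h8 : (t - (s + k * h)) ^ β ≤ h ^ β :=
          Real.rpow_le_rpow (by linarith) (by linarith) (by linarith)
        have h9 : (t - (s + k * h)) ^ (3 * β) ≤ h ^ (3 * β) :=
          Real.rpow_le_rpow (by linarith) (by linarith) (by linarith)
        calc ‖Y P t - x‖ = ‖(Y P t - Y P (s + k * h) - A (s + k * h) t (Y P (s + k * h))) +
              A (s + k * h) t (Y P (s + k * h)) + (Y P (s + k * h) - x)‖ := by congr 1; abel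
          _ ≤ K * h ^ (3 * β) + C * h ^ β + k * M := by
            refine norm_add_le_of_le (norm_add_le_of_le ?_ ?_) h5
            · exact h6.trans (by gcongr)
            · exact h7.trans (by gcongr)
          _ = (k + 1) * M := by rw [hM]; ring
  let F : Ultrafilter (Finset ℝ) := Ultrafilter.of atTop
  have hF : (F : Filter (Finset ℝ)) ≤ atTop := Ultrafilter.of_le _
  have hev : ∀ Q : Finset ℝ, ∀ᶠ P in (F : Filter (Finset ℝ)), Q ⊆ P := fun Q =>
    hF (eventually_ge_atTop Q)
  have hb2 : ∀ t, s ≤ t → t ≤ r → ∀ᶠ P in (F : Filter (Finset ℝ)), ‖Y P t - x‖ ≤ N * M := by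
    intro t h1 h2
    filter_upwards [hev (insert t G)] with P hP
    exact hbound P ((Finset.subset_insert _ _).trans hP) N le_rfl t
      (hP (Finset.mem_insert_self _ _)) h1 h2 (by linarith)
  have hlim : ∀ t, ∃ l : W, s ≤ t → t ≤ r → Tendsto (fun P => Y P t) F (𝓝 l) := by
    intro t
    by_cases hst : s ≤ t ∧ t ≤ r
    · have : ProperSpace W := FiniteDimensional.proper ℝ W
      obtain ⟨l, _, hl⟩ := (isCompact_closedBall x (N * M)).ultrafilter_le_nhds
        (F.map (fun P => Y P t)) (by
          rw [le_principal_iff]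
          change ∀ᶠ P in (F : Filter (Finset ℝ)), Y P t ∈ Metric.closedBall x (N * M)
          filter_upwards [hb2 t hst.1 hst.2] with P hP
          simpa [dist_eq_norm] using hP)
      exact ⟨l, fun _ _ => hl⟩
    · exact ⟨0, fun h1 h2 => absurd ⟨h1, h2⟩ hst⟩
  choose y hy using hlim
  have hyx : ∀ t, s ≤ t → t ≤ r → ‖y t - x‖ ≤ N * M := by
    intro t h1 h2
    exact le_of_tendsto ((hy t h1 h2).sub_const x).norm (hb2 t h1 h2)
  have hcont : ∀ u v, 0 ≤ u → u ≤ v → v ≤ r → Continuous (A u v) := by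
    intro u v h1 h2 h3
    refine (LipschitzWith.of_dist_le_mul (K := ⟨C * (v - u) ^ β, ?_⟩) ?_).continuous
    · have : 0 ≤ (v - u) ^ β := Real.rpow_nonneg (by linarith) _
      positivity
    · intro x x'
      rw [dist_eq_norm, dist_eq_norm]
      exact hA.lip u v h1 h2 h3 x x'
  have hloc : ∀ u v, s ≤ u → u ≤ v → v ≤ r → v - u ≤ h →
      ‖y v - y u - A u v (y u)‖ ≤ K * (v - u) ^ (3 * β) := by
    intro u v h1 h2 h3 h4
    have tu := hy u h1 (h2.trans h3)
    have tv := hy v (h1.trans h2) h3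
    have tA := ((hcont u v (hs.trans h1) h2 h3).tendsto (y u)).comp tu
    refine le_of_tendsto ((tv.sub tu).sub tA).norm ?_
    filter_upwards [hev {u, v}] with P hP
    exact hYd P u (hP (by simp)) v (hP (by simp)) h1 h2 h3 h4
  by_cases hsr : s ≤ r
  swap
  · exact ⟨fun _ => x, rfl, 0, le_rfl, fun u v h1 h2 h3 => absurd (h1.trans (h2.trans h3)) hsr⟩
  refine ⟨y, ?_, K + (2 * N * M + C * r ^ β) / h ^ (3 * β), by positivity, ?_⟩
  · have := hy s le_rfl hsr
    simp only [hYs] at this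
    exact tendsto_nhds_unique this tendsto_const_nhds
  · intro u v h1 h2 h3
    have hp : 0 ≤ (v - u) ^ (3 * β) := Real.rpow_nonneg (by linarith) _
    rcases le_or_gt (v - u) h with h4 | h4
    · refine (hloc u v h1 h2 h3 h4).trans ?_
      gcongr
      have : 0 ≤ (2 * N * M + C * r ^ β) / h ^ (3 * β) := by positivity
      linarith
    · have h5 := hyx u h1 (h2.trans h3)
      have h6 := hyx v (h1.trans h2) h3
      have h7 := hA.bd u v (by linarith) h2 h3 (y u)
      have h8 : (v - u) ^ β ≤ r ^ β :=
          Real.rpow_le_rpow (by linarith) (by linarith) (by linarith)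
      have h9 : h ^ (3 * β) ≤ (v - u) ^ (3 * β) :=
          Real.rpow_le_rpow (by linarith) (by linarith) (by linarith)
      have hhp : 0 < h ^ (3 * β) := by positivity
      calc ‖y v - y u - A u v (y u)‖ = ‖(y v - x) - (y u - x) - A u v (y u)‖ := by congr 1; abel
        _ ≤ N * M + N * M + C * r ^ β :=
          norm_sub_le_of_le (norm_sub_le_of_le h6 h5) (h7.trans (by gcongr))
        _ = (2 * N * M + C * r ^ β) / h ^ (3 * β) * h ^ (3 * β) := by
          field_simp; ring
        _ ≤ (2 * N * M + C * r ^ β) / h ^ (3 * β) * (v - u) ^ (3 * β) := by gcongr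
        _ ≤ _ := by gcongr; linarith

theorem AF.uniq_step (hA : AF A r β C) {s K : ℝ} (hs : 0 ≤ s) (hK : 0 ≤ K) {y z : ℝ → W}
    (hy : Davie A r β s K y) (hz : Davie A r β s K z) :
    ∃ h > (0:ℝ), ∀ s0, s ≤ s0 → y s0 = z s0 → ∀ t, s0 ≤ t → t ≤ r → t ≤ s0 + h → y t = z t := by
  have hβ := hA.hβ
  have hC := hA.hC
  have hr := hA.hr
  have hq1 : (1 / 2 : ℝ) ^ (3 * β) < 1 / 2 := half_rpow_lt (by linarith)
  have hq0 : 0 ≤ (1 / 2 : ℝ) ^ (3 * β) := by positivity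
  set q : ℝ := (1 / 2 : ℝ) ^ (3 * β) with hq
  obtain ⟨h1, hh10, hh1⟩ := exists_small C (1 - 2 * q) β hC (by linarith) (by linarith)
  set κ : ℝ := (2 + (1 - 2 * q)) * q with hκ
  have hκ0 : 0 ≤ κ := mul_nonneg (by linarith) hq0
  have hκ1 : κ < 1 := by
    have : 0 < (1 - 2 * q) * (1 - q) := mul_pos (by linarith) (by linarith)
    rw [hκ]; nlinarith
  obtain ⟨h2, hh20, hh2⟩ := exists_small ((2 * K + C) / (1 - κ)) (1 / 2) (3 * β)
    (div_nonneg (by positivity) (by linarith)) (by norm_num) (by linarith)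
  refine ⟨min h1 h2, lt_min hh10 hh20, ?_⟩
  intro s0 hs0 heq t0 ht0 ht0r ht0h
  have hsh1 : t0 ≤ s0 + h1 := ht0h.trans (by gcongr; exact min_le_left _ _)
  have hsh2 : t0 ≤ s0 + h2 := ht0h.trans (by gcongr; exact min_le_right _ _)
  have key : ∀ S : ℝ, 0 ≤ S → (∀ t, s0 ≤ t → t ≤ t0 → ‖z t - y t‖ ≤ S) →
      ∀ t, s0 ≤ t → t ≤ t0 → ‖z t - y t‖ ≤ S / 2 := by
    intro S hS0 hS
    let R : ℝ → ℝ → W := fun u v => (z v - z u - A u v (z u)) - (y v - y u - A u v (y u))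
    have step : ∀ c : ℝ, 0 ≤ c →
        (∀ u v, s0 ≤ u → u ≤ v → v ≤ t0 → ‖R u v‖ ≤ c * (v - u) ^ (3 * β)) →
        ∀ u v, s0 ≤ u → u ≤ v → v ≤ t0 →
          ‖R u v‖ ≤ (κ * c + (2 * K + C) * S) * (v - u) ^ (3 * β) := by
      intro c hc0 hc u v hu huv hv
      set w := (u + v) / 2 with hw
      have huw : u ≤ w := by linarith
      have hwv : w ≤ v := by linarith
      have a1 := hc u w hu huw (by linarith)
      have a2 := hc w v (by linarith) hwv hv
      have a3 := hA.four w v (by linarith) hwv (by linarith) (z u + A u w (z u))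
        (y u + A u w (y u)) (z w - z u - A u w (z u)) (y w - y u - A u w (y u))
      have a4 := hA.dlip u w v (by linarith) huw hwv (by linarith) (z u) (y u)
      have a5 := hA.lip u w (by linarith) huw (by linarith) (z u) (y u)
      have a6 := hy u w (by linarith) huw (by linarith)
      have a7 := hS u hu (by linarith)
      have a8 := hh1 (v - w) (by linarith) (by linarith)
      have a9 := hh1 (w - u) (by linarith) (by linarith)
      have ez : z u + A u w (z u) + (z w - z u - A u w (z u)) = z w := by abel
      have ey : y u + A u w (y u) + (y w - y u - A u w (y u)) = y w := by abel
      rw [ez, ey] at a3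
      have ha' := half_len_rpow (θ := 3 * β) (l := v - u) (m := w - u) (by linarith) (by linarith) (by linarith)
      have hb' := half_len_rpow (θ := 3 * β) (l := v - u) (m := v - w) (by linarith) (by linarith) (by linarith)
      have hl0 : 0 ≤ (v - u) ^ (3 * β) := Real.rpow_nonneg (by linarith) _
      rw [← hq] at ha' hb'
      have hc' : (w - u) ^ (3 * β) ≤ (v - u) ^ (3 * β) :=
        Real.rpow_le_rpow (by linarith) (by linarith) (by linarith)
      set T := (v - u) ^ (3 * β)
      have e : R u v = R w v +
          (A w v (z w) - A w v (z u + A u w (z u)) - (A w v (y w) - A w v (y u + A u w (y u)))) +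
          ((A w v (z u + A u w (z u)) + A u w (z u) - A u v (z u)) -
            (A w v (y u + A u w (y u)) + A u w (y u) - A u v (y u))) + R u w := by
        simp only [R]; abel
      have b1 : ‖R u w‖ ≤ c * (q * T) := a1.trans (by gcongr)
      have b2 : ‖z u + A u w (z u) - (y u + A u w (y u))‖ ≤ 2 * S := by
        calc _ = ‖(z u - y u) + (A u w (z u) - A u w (y u))‖ := by congr 1; abel
          _ ≤ S + 1 * S := by
            refine norm_add_le_of_le a7 (a5.trans ?_)
            exact mul_le_mul (by linarith) a7 (norm_nonneg _) (by norm_num)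
          _ = 2 * S := by ring
      have b3 : ‖y w - y u - A u w (y u)‖ ≤ K * T := a6.trans (by gcongr)
      have b4 : ‖z u + A u w (z u) - (y u + A u w (y u))‖ * ‖y w - y u - A u w (y u)‖
          ≤ 2 * S * (K * T) := mul_le_mul b2 b3 (norm_nonneg _) (by positivity)
      have b0 : 0 ≤ 2 * S * (K * T) := by positivity
      calc ‖R u v‖ ≤ c * (q * T) + ((1 - 2 * q) * (c * (q * T)) + 2 * S * (K * T)) + C * T * S
            + c * (q * T) := by
            rw [e]
            refine norm_add_le_of_le (norm_add_le_of_le (norm_add_le_of_le ?_ ?_) ?_) b1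
            · exact a2.trans (by gcongr)
            · refine a3.trans ?_
              calc _ ≤ (1 - 2 * q) * (c * (q * T) + 2 * S * (K * T)) := by
                    refine mul_le_mul a8 (add_le_add b1 b4) (by positivity) (by linarith)
                _ ≤ _ := by nlinarith
            · exact a4.trans (by gcongr)
        _ = (κ * c + (2 * K + C) * S) * T := by rw [hκ]; ring
    have iter : ∀ n : ℕ, ∀ u v, s0 ≤ u → u ≤ v → v ≤ t0 →
        ‖R u v‖ ≤ (2 * K * κ ^ n + (2 * K + C) / (1 - κ) * S) * (v - u) ^ (3 * β) := by
      have hL0 : 0 ≤ (2 * K + C) / (1 - κ) * S :=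
        mul_nonneg (div_nonneg (by positivity) (by linarith)) hS0
      intro n
      induction n with
      | zero =>
        intro u v hu huv hv
        have hl0 : 0 ≤ (v - u) ^ (3 * β) := Real.rpow_nonneg (by linarith) _
        calc ‖R u v‖ ≤ K * (v - u) ^ (3 * β) + K * (v - u) ^ (3 * β) :=
              norm_sub_le_of_le (hz u v (by linarith) huv (by linarith))
                (hy u v (by linarith) huv (by linarith))
          _ ≤ _ := by rw [pow_zero]; nlinarith [mul_nonneg hL0 hl0]
      | succ n ih =>
        intro u v hu huv hv
        refine (step _ (by positivity) ih u v hu huv hv).trans (le_of_eq ?_)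
        congr 1
        have : 1 - κ ≠ 0 := by linarith
        field_simp
        ring
    intro t ht htt
    have hR : ‖R s0 t‖ ≤ (2 * K + C) / (1 - κ) * S * (t - s0) ^ (3 * β) := by
      have hlim : Tendsto (fun n : ℕ => (2 * K * κ ^ n + (2 * K + C) / (1 - κ) * S) *
          (t - s0) ^ (3 * β)) atTop
          (𝓝 ((2 * K * 0 + (2 * K + C) / (1 - κ) * S) * (t - s0) ^ (3 * β))) :=
        (((tendsto_pow_atTop_nhds_zero_of_lt_one hκ0 hκ1).const_mul _).add_const _).mul_const _
      rw [mul_zero, zero_add] at hlim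
      exact ge_of_tendsto' hlim (fun n => iter n s0 t le_rfl ht htt)
    have e : R s0 t = z t - y t := by
      simp only [R, heq]; abel
    rw [e] at hR
    have := hh2 (t - s0) (by linarith) (by linarith)
    calc _ ≤ _ := hR
      _ = ((2 * K + C) / (1 - κ) * (t - s0) ^ (3 * β)) * S := by ring
      _ ≤ 1 / 2 * S := by gcongr
      _ = S / 2 := by ring
  set S0 : ℝ := 2 * (K * r ^ (3 * β) + C * r ^ β) with hS0
  have hS00 : 0 ≤ S0 := by positivity
  have base : ∀ y : ℝ → W, Davie A r β s K y → ∀ t, s0 ≤ t → t ≤ t0 →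
      ‖y t - y s0‖ ≤ K * r ^ (3 * β) + C * r ^ β := by
    intro y hy t h1 h2
    have b1 := hy s0 t hs0 h1 (by linarith)
    have b2 := hA.bd s0 t (by linarith) h1 (by linarith) (y s0)
    have h8 : (t - s0) ^ β ≤ r ^ β :=
      Real.rpow_le_rpow (by linarith) (by linarith) (by linarith)
    have h9 : (t - s0) ^ (3 * β) ≤ r ^ (3 * β) :=
      Real.rpow_le_rpow (by linarith) (by linarith) (by linarith)
    calc ‖y t - y s0‖ = ‖(y t - y s0 - A s0 t (y s0)) + A s0 t (y s0)‖ := by congr 1; abel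
      _ ≤ _ := norm_add_le_of_le (b1.trans (by gcongr)) (b2.trans (by gcongr))
  have all : ∀ n : ℕ, ∀ t, s0 ≤ t → t ≤ t0 → ‖z t - y t‖ ≤ S0 / 2 ^ n := by
    intro n
    induction n with
    | zero =>
      intro t h1 h2
      calc ‖z t - y t‖ = ‖(z t - z s0) - (y t - y s0)‖ := by rw [heq]; congr 1; abel
        _ ≤ (K * r ^ (3 * β) + C * r ^ β) + (K * r ^ (3 * β) + C * r ^ β) :=
          norm_sub_le_of_le (base z hz t h1 h2) (base y hy t h1 h2)
        _ = S0 / 2 ^ 0 := by rw [hS0]; ring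
    | succ n ih =>
      have := key (S0 / 2 ^ n) (by positivity) ih
      intro t h1 h2
      refine (this t h1 h2).trans (le_of_eq ?_)
      rw [pow_succ]; field_simp
  have h0 : ‖z t0 - y t0‖ ≤ 0 := by
    have hlim : Tendsto (fun n : ℕ => S0 * (1 / 2 : ℝ) ^ n) atTop (𝓝 (S0 * 0)) :=
      (tendsto_pow_atTop_nhds_zero_of_lt_one (by norm_num) (by norm_num)).const_mul _
    rw [mul_zero] at hlim
    refine ge_of_tendsto' hlim (fun n => ?_)
    refine (all n t0 ht0 le_rfl).trans (le_of_eq ?_)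
    rw [one_div, inv_pow]; rfl
  have := norm_le_zero_iff.1 h0
  exact (sub_eq_zero.1 this).symm

theorem AF.uniq (hA : AF A r β C) {s K K' : ℝ} (hs : 0 ≤ s) {y z : ℝ → W}
    (hy : Davie A r β s K y) (hz : Davie A r β s K' z) (heq : y s = z s) :
    ∀ t, s ≤ t → t ≤ r → y t = z t := by
  have up : ∀ {k : ℝ} {f : ℝ → W}, k ≤ max 0 (max K K') → Davie A r β s k f →
      Davie A r β s (max 0 (max K K')) f := by
    intro k f hk hf u v h1 h2 h3
    have : 0 ≤ (v - u) ^ (3 * β) := Real.rpow_nonneg (by linarith) _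
    exact (hf u v h1 h2 h3).trans (by gcongr)
  obtain ⟨h, hh0, hh⟩ := hA.uniq_step hs (le_max_left 0 (max K K')) (up (by simp) hy) (up (by simp) hz)
  have : ∀ n : ℕ, ∀ t, s ≤ t → t ≤ r → t ≤ s + n * h → y t = z t := by
    intro n
    induction n with
    | zero =>
      intro t h1 _ h2
      have : t = s := by
        push_cast at h2
        linarith
      rw [this, heq]
    | succ n ih =>
      intro t h1 h2 h3
      push_cast at h3
      rcases le_or_gt t (s + n * h) with h4 | h4
      · exact ih t h1 h2 h4
      · have hn0 : (0:ℝ) ≤ n * h := by positivity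
        exact hh (s + n * h) (by linarith) (ih _ (by linarith) (by linarith) le_rfl) t h4.le h2
          (by linarith)
  intro t h1 h2
  obtain ⟨N, hN⟩ := exists_nat_ge ((t - s) / h)
  rw [div_le_iff₀ hh0] at hN
  exact this N t h1 h2 (by linarith)

end AlmostFlow

end SDDE

set_option linter.unusedSectionVars false
set_option linter.unusedVariables false

namespace SDDE

open Set Filter Topology

section Calculus

variable {D E F G W ι : Type*} [NormedAddCommGroup D] [NormedSpace ℝ D]
  [NormedAddCommGroup E] [NormedSpace ℝ E] [NormedAddCommGroup F] [NormedSpace ℝ F]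
  [NormedAddCommGroup G] [NormedSpace ℝ G]
  [NormedAddCommGroup W] [NormedSpace ℝ W]

theorem CnBounded.fderiv {n : ℕ} {f : D → E} (h : CnBounded (n + 1) f) :
    CnBounded n (fderiv ℝ f) := by
  refine ⟨h.1.fderiv_right (by norm_cast), fun i hi => ?_⟩
  obtain ⟨C, hC⟩ := h.2 (i + 1) (by omega)
  exact ⟨C, fun x => by rw [norm_iteratedFDeriv_fderiv]; exact hC x⟩

theorem CnBounded.of_le {n m : ℕ} {f : D → E} (h : CnBounded n f) (hm : m ≤ n) :
    CnBounded m f :=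
  ⟨h.1.of_le (by exact_mod_cast hm), fun i hi => h.2 i (hi.trans hm)⟩

theorem CnBounded.clm {n : ℕ} {f : D → E} (h : CnBounded n f) (L : E →L[ℝ] F) :
    CnBounded n (fun x => L (f x)) := by
  refine ⟨L.contDiff.comp h.1, fun i hi => ?_⟩
  obtain ⟨C, hC⟩ := h.2 i hi
  refine ⟨‖L‖ * C, fun x => ?_⟩
  refine (L.norm_iteratedFDeriv_comp_left (f := f) (N := n) h.1.contDiffAt
    (by exact_mod_cast hi)).trans ?_
  gcongr
  exact hC x

theorem CnBounded.bilin {n : ℕ} {f : D → E} {g : D → F} (hf : CnBounded n f) (hg : CnBounded n g)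
    (B : E →L[ℝ] F →L[ℝ] G) : CnBounded n (fun x => B (f x) (g x)) := by
  refine ⟨B.isBoundedBilinearMap.contDiff.comp (hf.1.prodMk hg.1), fun i hi => ?_⟩
  choose! Cf hCf using hf.2
  choose! Cg hCg using hg.2
  refine ⟨‖B‖ * ∑ j ∈ Finset.range (i + 1), (i.choose j : ℝ) * Cf j * Cg (i - j), fun x => ?_⟩
  refine (B.norm_iteratedFDeriv_le_of_bilinear hf.1 hg.1 x (by exact_mod_cast hi)).trans ?_
  gcongr with j hj
  · exact mul_nonneg (by positivity) ((norm_nonneg _).trans (hCf j (by simp at hj; omega) x))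
  · exact hCf j (by simp at hj; omega) x
  · exact hCg (i - j) (by omega) x

/-- Twice differentiable with bounds (Lipschitz derivative). -/
def Sm2 (f : D → E) (M : ℝ) : Prop :=
  0 ≤ M ∧ Differentiable ℝ f ∧ (∀ p, ‖f p‖ ≤ M) ∧ (∀ p, ‖fderiv ℝ f p‖ ≤ M) ∧
    ∀ p q, ‖fderiv ℝ f p - fderiv ℝ f q‖ ≤ M * ‖p - q‖

theorem CnBounded.sm2 {f : D → E} (h : CnBounded 2 f) : ∃ M, Sm2 f M := by
  obtain ⟨C0, h0⟩ := h.2 0 (by norm_num)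
  obtain ⟨C1, h1⟩ := h.2 1 (by norm_num)
  obtain ⟨C2, h2⟩ := h.2 2 (by norm_num)
  have hd : Differentiable ℝ f := h.1.differentiable (by norm_num)
  have hdd : Differentiable ℝ (_root_.fderiv ℝ f) :=
    (CnBounded.fderiv (n := 1) h).1.differentiable (by norm_num)
  have n0 := (norm_nonneg _).trans (h0 0)
  have n1 := (norm_nonneg _).trans (h1 0)
  have n2 := (norm_nonneg _).trans (h2 0)
  refine ⟨C0 + C1 + C2, by positivity, hd, fun p => ?_, fun p => ?_, fun p q => ?_⟩
  · have := h0 p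
    rw [norm_iteratedFDeriv_zero] at this
    linarith
  · have := h1 p
    rw [norm_iteratedFDeriv_one] at this
    linarith
  · have := (convex_univ (𝕜 := ℝ) (E := D)).norm_image_sub_le_of_norm_fderiv_le
      (f := _root_.fderiv ℝ f) (C := C2) (𝕜 := ℝ) (fun x _ => hdd x) (fun x _ => by
        have := h2 x
        rwa [← norm_iteratedFDeriv_fderiv, norm_iteratedFDeriv_one] at this)
      (mem_univ q) (mem_univ p)
    refine this.trans ?_
    gcongr
    linarith

theorem Sm2.lip {f : D → E} {M : ℝ} (h : Sm2 f M) (p q : D) : ‖f p - f q‖ ≤ M * ‖p - q‖ :=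
  (convex_univ (𝕜 := ℝ) (E := D)).norm_image_sub_le_of_norm_fderiv_le (𝕜 := ℝ)
    (fun x _ => h.2.1 x) (fun x _ => h.2.2.2.1 x) (mem_univ q) (mem_univ p)

theorem hasFDerivAt_shift {f : D → E} (hf : Differentiable ℝ f) (p x : D) :
    HasFDerivAt (fun x => f (p + x)) (fderiv ℝ f (p + x)) x := by
  have := (hf (p + x)).hasFDerivAt.comp x ((hasFDerivAt_id x).const_add p)
  rwa [ContinuousLinearMap.comp_id] at this

theorem Sm2.four {f : D → E} {M : ℝ} (hf : Sm2 f M) (p q h k : D) :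
    ‖f (p + h) - f p - (f (q + k) - f q)‖ ≤ M * (‖h - k‖ + ‖p - q‖ * ‖k‖) := by
  have h1 := hf.lip (p + h) (p + k)
  have e1 : p + h - (p + k) = h - k := by abel
  rw [e1] at h1
  have hder : ∀ x, HasFDerivAt (fun x => f (p + x) - f (q + x))
      (fderiv ℝ f (p + x) - fderiv ℝ f (q + x)) x := by
    intro x
    exact (hasFDerivAt_shift hf.2.1 p x).sub
      (hasFDerivAt_shift hf.2.1 q x)
  have h2 := (convex_univ (𝕜 := ℝ) (E := D)).norm_image_sub_le_of_norm_hasFDerivWithin_le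
    (f := fun x => f (p + x) - f (q + x)) (C := M * ‖p - q‖)
    (fun x _ => (hder x).hasFDerivWithinAt) (fun x _ => by
      have := hf.2.2.2.2 (p + x) (q + x)
      rwa [add_sub_add_right_eq_sub] at this)
    (mem_univ 0) (mem_univ k)
  simp only [add_zero, sub_zero] at h2
  calc _ = ‖(f (p + h) - f (p + k)) + (f (p + k) - f (q + k) - (f p - f q))‖ := by congr 1; abel
    _ ≤ M * ‖h - k‖ + M * ‖p - q‖ * ‖k‖ := norm_add_le_of_le h1 h2
    _ = _ := by ring

theorem Sm2.taylor {f : D → E} {M : ℝ} (hf : Sm2 f M) (hf' : Sm2 (fderiv ℝ f) M) (p q h k : D)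
    (c : ℝ) (hh : ‖h‖ ≤ c) (hk : ‖k‖ ≤ c) :
    ‖(f (p + h) - f p - fderiv ℝ f p h) - (f (q + k) - f q - fderiv ℝ f q k)‖
      ≤ M * c * ‖h - k‖ + M * ‖p - q‖ * c * c := by
  have hM := hf.1
  have hc : 0 ≤ c := (norm_nonneg _).trans hh
  have h1 := (convex_closedBall (0 : D) c).norm_image_sub_le_of_norm_hasFDerivWithin_le'
    (f := fun x => f (p + x)) (C := M * c) (φ := fderiv ℝ f p)
    (fun x _ => (hasFDerivAt_shift hf.2.1 p x).hasFDerivWithinAt) (fun x hx => by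
      have := hf.2.2.2.2 (p + x) p
      rw [add_sub_cancel_left] at this
      refine this.trans ?_
      gcongr
      simpa using hx) (x := k) (y := h) (by simpa using hk) (by simpa using hh)
  have hder : ∀ x, HasFDerivAt (fun x => f (p + x) - f (q + x))
      (fderiv ℝ f (p + x) - fderiv ℝ f (q + x)) x := by
    intro x
    exact (hasFDerivAt_shift hf.2.1 p x).sub
      (hasFDerivAt_shift hf.2.1 q x)
  have h2 := (convex_closedBall (0 : D) c).norm_image_sub_le_of_norm_hasFDerivWithin_le'
    (f := fun x => f (p + x) - f (q + x)) (C := M * ‖p - q‖ * c)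
    (φ := fderiv ℝ f p - fderiv ℝ f q)
    (fun x _ => (hder x).hasFDerivWithinAt) (fun x hx => by
      have := hf'.four p q x x
      rw [sub_self, norm_zero, zero_add] at this
      calc _ = ‖fderiv ℝ f (p + x) - fderiv ℝ f p - (fderiv ℝ f (q + x) - fderiv ℝ f q)‖ := by
            congr 1; abel
        _ ≤ _ := this
        _ = M * ‖p - q‖ * ‖x‖ := by ring
        _ ≤ _ := by
          gcongr
          simpa using hx)
    (x := 0) (y := k) (by simpa using hc) (by simpa using hk)
  simp only [add_zero, sub_zero, _root_.sub_apply] at h2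
  rw [map_sub] at h1
  calc _ = ‖(f (p + h) - f (p + k) - (fderiv ℝ f p h - fderiv ℝ f p k)) +
        (f (p + k) - f (q + k) - (f p - f q) - (fderiv ℝ f p k - fderiv ℝ f q k))‖ := by
        congr 1; abel
    _ ≤ M * c * ‖h - k‖ + M * ‖p - q‖ * c * ‖k‖ := norm_add_le_of_le h1 h2
    _ ≤ _ := by gcongr

/-- Bounded and Lipschitz with constant `c`. -/
def BL (f : W → E) (c : ℝ) : Prop :=
  (∀ x, ‖f x‖ ≤ c) ∧ ∀ x x', ‖f x - f x'‖ ≤ c * ‖x - x'‖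

/-- Uniformly in `i`, `F i` is bounded and Lipschitz of size `e i ^ k`. -/
def Ord (e : ι → ℝ) (k : ℕ) (f : ι → W → E) : Prop :=
  ∃ C, 0 ≤ C ∧ ∀ i, BL (f i) (C * e i ^ k)

/-- `a i` is of size `e i ^ k`. -/
def Sz (e : ι → ℝ) (k : ℕ) (a : ι → E) : Prop :=
  ∃ C, 0 ≤ C ∧ ∀ i, ‖a i‖ ≤ C * e i ^ k

variable {e : ι → ℝ}

theorem Sz.ord (he : ∀ i, 0 ≤ e i) {k : ℕ} {a : ι → E} (h : Sz e k a) :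
    Ord e k (fun i (_ : W) => a i) := by
  obtain ⟨C, hC, h⟩ := h
  refine ⟨C, hC, fun i => ⟨fun _ => h i, fun x x' => ?_⟩⟩
  rw [sub_self, norm_zero]
  have := he i
  positivity

theorem Ord.add {k : ℕ} {f g : ι → W → E} (hf : Ord e k f) (hg : Ord e k g) :
    Ord e k (fun i x => f i x + g i x) := by
  obtain ⟨C, hC, hf⟩ := hf
  obtain ⟨C', hC', hg⟩ := hg
  refine ⟨C + C', by positivity, fun i => ⟨fun x => ?_, fun x x' => ?_⟩⟩
  · exact (norm_add_le_of_le ((hf i).1 x) ((hg i).1 x)).trans (le_of_eq (by ring))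
  · rw [add_sub_add_comm]
    exact (norm_add_le_of_le ((hf i).2 x x') ((hg i).2 x x')).trans (le_of_eq (by ring))

theorem Ord.bound (he : ∀ i, 0 ≤ e i) {k : ℕ} {f : ι → W → E} {g : ι → W → F} (hf : Ord e k f)
    {K : ℝ} (hK : 0 ≤ K) (h1 : ∀ i x, ‖g i x‖ ≤ K * ‖f i x‖)
    (h2 : ∀ i x x', ‖g i x - g i x'‖ ≤ K * ‖f i x - f i x'‖) : Ord e k g := by
  obtain ⟨C, hC, hf⟩ := hf
  refine ⟨K * C, by positivity, fun i => ⟨fun x => ?_, fun x x' => ?_⟩⟩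
  · refine (h1 i x).trans ?_
    rw [mul_assoc]
    have := (hf i).1 x
    gcongr
  · refine (h2 i x x').trans ?_
    rw [mul_assoc, mul_assoc, ← mul_assoc C]
    have := (hf i).2 x x'
    gcongr

theorem Ord.neg (he : ∀ i, 0 ≤ e i) {k : ℕ} {f : ι → W → E} (hf : Ord e k f) :
    Ord e k (fun i x => - f i x) := by
  refine hf.bound he zero_le_one (fun i x => by simp) (fun i x x' => ?_)
  rw [neg_sub_neg, norm_sub_rev, one_mul]

theorem Ord.sub (he : ∀ i, 0 ≤ e i) {k : ℕ} {f g : ι → W → E} (hf : Ord e k f) (hg : Ord e k g) :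
    Ord e k (fun i x => f i x - g i x) := by
  simpa only [sub_eq_add_neg] using hf.add (hg.neg he)

theorem Ord.lower (he : ∀ i, 0 ≤ e i) {B : ℝ} (hB : ∀ i, e i ≤ B) (hB0 : 0 ≤ B) {k j : ℕ}
    (hjk : j ≤ k) {f : ι → W → E} (hf : Ord e k f) : Ord e j f := by
  obtain ⟨C, hC, hf⟩ := hf
  have key : ∀ i, C * e i ^ k ≤ C * B ^ (k - j) * e i ^ j := by
    intro i
    have := he i
    calc C * e i ^ k = C * (e i ^ (k - j) * e i ^ j) := by rw [← pow_add]; congr 3; omega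
      _ ≤ C * (B ^ (k - j) * e i ^ j) := by
        have := hB i
        gcongr
      _ = _ := by ring
  refine ⟨C * B ^ (k - j), by positivity, fun i => ⟨fun x => ((hf i).1 x).trans (key i),
    fun x x' => ((hf i).2 x x').trans ?_⟩⟩
  have := key i
  gcongr

theorem Ord.bilin (he : ∀ i, 0 ≤ e i) {j k : ℕ} {f : ι → W → E} {g : ι → W → F}
    (hf : Ord e j f) (hg : Ord e k g) (B : E → F → G) {K : ℝ} (hK : 0 ≤ K)
    (hB : ∀ a b, ‖B a b‖ ≤ K * ‖a‖ * ‖b‖)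
    (hB2 : ∀ a a' b b', B a b - B a' b' = B (a - a') b + B a' (b - b')) :
    Ord e (j + k) (fun i x => B (f i x) (g i x)) := by
  obtain ⟨C, hC, hf⟩ := hf
  obtain ⟨C', hC', hg⟩ := hg
  refine ⟨2 * K * C * C', by positivity, fun i => ⟨fun x => ?_, fun x x' => ?_⟩⟩
  · have := he i
    calc _ ≤ K * ‖f i x‖ * ‖g i x‖ := hB _ _
      _ ≤ K * (C * e i ^ j) * (C' * e i ^ k) := by
        have a1 := (hf i).1 x
        have a2 := (hg i).1 x
        gcongr
      _ = 1 * (K * C * C' * e i ^ (j + k)) := by rw [pow_add]; ring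
      _ ≤ 2 * (K * C * C' * e i ^ (j + k)) := by gcongr; norm_num
      _ = _ := by ring
  · have := he i
    rw [hB2]
    calc _ ≤ K * ‖f i x - f i x'‖ * ‖g i x‖ + K * ‖f i x'‖ * ‖g i x - g i x'‖ :=
          norm_add_le_of_le (hB _ _) (hB _ _)
      _ ≤ K * (C * e i ^ j * ‖x - x'‖) * (C' * e i ^ k) +
          K * (C * e i ^ j) * (C' * e i ^ k * ‖x - x'‖) := by
        have a1 := (hf i).1 x'
        have a2 := (hg i).1 x
        have a3 := (hf i).2 x x'
        have a4 := (hg i).2 x x'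
        gcongr
      _ = _ := by rw [pow_add]; ring

theorem Ord.clm_apply (he : ∀ i, 0 ≤ e i) {j k : ℕ} {f : ι → W → E →L[ℝ] F} {g : ι → W → E}
    (hf : Ord e j f) (hg : Ord e k g) : Ord e (j + k) (fun i x => f i x (g i x)) := by
  refine hf.bilin he hg (fun a b => a b) zero_le_one (fun a b => ?_) (fun a a' b b' => ?_)
  · rw [one_mul]; exact a.le_opNorm b
  · simp

theorem Ord.clm_comp (he : ∀ i, 0 ≤ e i) {j k : ℕ} {f : ι → W → E →L[ℝ] F} {g : ι → W → G →L[ℝ] E}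
    (hf : Ord e j f) (hg : Ord e k g) : Ord e (j + k) (fun i x => (f i x).comp (g i x)) := by
  refine hf.bilin he hg (fun a b => a.comp b) zero_le_one (fun a b => ?_) (fun a a' b b' => ?_)
  · rw [one_mul]; exact a.opNorm_comp_le b
  · ext; simp

theorem Ord.prodMk (he : ∀ i, 0 ≤ e i) {k : ℕ} {f : ι → W → E} {g : ι → W → F}
    (hf : Ord e k f) (hg : Ord e k g) : Ord e k (fun i x => (f i x, g i x)) := by
  obtain ⟨C, hC, hf⟩ := hf
  obtain ⟨C', hC', hg⟩ := hg
  refine ⟨C + C', by positivity, fun i => ⟨fun x => ?_, fun x x' => ?_⟩⟩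
  · have := pow_nonneg (he i) k
    have a1 := (hf i).1 x
    have a2 := (hg i).1 x
    rw [Prod.norm_def]
    refine max_le ?_ ?_ <;> nlinarith
  · have := pow_nonneg (he i) k
    have a1 := (hf i).2 x x'
    have a2 := (hg i).2 x x'
    have b1 : 0 ≤ C * e i ^ k * ‖x - x'‖ := by positivity
    have b2 : 0 ≤ C' * e i ^ k * ‖x - x'‖ := by positivity
    rw [Prod.mk_sub_mk, Prod.norm_def]
    refine max_le ?_ ?_ <;> simp only [] <;> nlinarith

theorem pair_norm (x x' : W) (c : F) : ‖((x, c) : W × F) - (x', c)‖ = ‖x - x'‖ := by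
  rw [Prod.mk_sub_mk, Prod.norm_def]; simp

theorem Ord.smooth {f : W × F → E} {M : ℝ} (hf : Sm2 f M) (c : ι → F) :
    Ord e 0 (fun i x => f (x, c i)) := by
  refine ⟨M, hf.1, fun i => ⟨fun x => by simpa using hf.2.2.1 _, fun x x' => ?_⟩⟩
  have := hf.lip (x, c i) (x', c i)
  rw [pair_norm] at this
  simpa using this

theorem Ord.diff (he : ∀ i, 0 ≤ e i) {f : W × F → E} {M : ℝ} (hf : Sm2 f M) (c : ι → F) {k : ℕ}
    {h : ι → W → W × F} (hh : Ord e k h) :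
    Ord e k (fun i x => f ((x, c i) + h i x) - f (x, c i)) := by
  obtain ⟨C, hC, hh⟩ := hh
  have hM := hf.1
  refine ⟨2 * M * C, by positivity, fun i => ⟨fun x => ?_, fun x x' => ?_⟩⟩
  · have := he i
    refine (hf.lip _ _).trans ?_
    rw [add_sub_cancel_left]
    have a1 := (hh i).1 x
    have : M * ‖h i x‖ ≤ M * (C * e i ^ k) := by gcongr
    have : 0 ≤ M * (C * e i ^ k) := by positivity
    linarith
  · have := he i
    refine (hf.four _ _ _ _).trans ?_
    rw [pair_norm]
    have a1 := (hh i).1 x'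
    have a2 := (hh i).2 x x'
    calc _ ≤ M * (C * e i ^ k * ‖x - x'‖ + ‖x - x'‖ * (C * e i ^ k)) := by gcongr
      _ = _ := by ring

theorem Ord.taylor (he : ∀ i, 0 ≤ e i) {f : W × F → E} {M : ℝ} (hf : Sm2 f M)
    (hf' : Sm2 (fderiv ℝ f) M) (c : ι → F) {k : ℕ}
    {h : ι → W → W × F} (hh : Ord e k h) :
    Ord e (k + k) (fun i x => f ((x, c i) + h i x) - f (x, c i) - fderiv ℝ f (x, c i) (h i x)) := by
  obtain ⟨C, hC, hh⟩ := hh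
  have hM := hf.1
  refine ⟨2 * M * C * C, by positivity, fun i => ⟨fun x => ?_, fun x x' => ?_⟩⟩
  · have hei := he i
    have a1 := (hh i).1 x
    have := hf.taylor hf' (x, c i) (x, c i) (h i x) 0 (C * e i ^ k) a1 (by simp; positivity)
    simp only [add_zero, sub_self, map_zero, sub_zero, norm_zero, mul_zero, zero_mul] at this
    refine this.trans ?_
    calc _ ≤ 1 * (M * (C * e i ^ k) * (C * e i ^ k)) := by rw [one_mul]; gcongr
      _ ≤ 2 * (M * (C * e i ^ k) * (C * e i ^ k)) := by gcongr; norm_num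
      _ = _ := by rw [pow_add]; ring
  · have hei := he i
    have a1 := (hh i).1 x
    have a2 := (hh i).1 x'
    have a3 := (hh i).2 x x'
    refine (hf.taylor hf' _ _ _ _ _ a1 a2).trans ?_
    rw [pair_norm]
    calc _ ≤ M * (C * e i ^ k) * (C * e i ^ k * ‖x - x'‖) + M * ‖x - x'‖ * (C * e i ^ k) * (C * e i ^ k) := by
          gcongr
      _ = _ := by rw [pow_add]; ring

/-- Uniform four-point bounds. -/
def OrdF (e : ι → ℝ) (k : ℕ) (f : ι → W → E) : Prop :=
  ∃ C, 0 ≤ C ∧ ∀ i, ∀ a b h h', ‖f i (a + h) - f i a - (f i (b + h') - f i b)‖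
    ≤ C * e i ^ k * (‖h - h'‖ + ‖a - b‖ * ‖h'‖)

theorem OrdF.add {k : ℕ} {f g : ι → W → E} (hf : OrdF e k f) (hg : OrdF e k g) :
    OrdF e k (fun i x => f i x + g i x) := by
  obtain ⟨C, hC, hf⟩ := hf
  obtain ⟨C', hC', hg⟩ := hg
  refine ⟨C + C', by positivity, fun i a b h h' => ?_⟩
  calc _ = ‖(f i (a + h) - f i a - (f i (b + h') - f i b)) +
        (g i (a + h) - g i a - (g i (b + h') - g i b))‖ := by congr 1; dsimp only; abel
    _ ≤ _ := norm_add_le_of_le (hf i a b h h') (hg i a b h h')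
    _ = _ := by ring

theorem OrdF.smooth {f : W × F → E} {M : ℝ} (hf : Sm2 f M) (c : ι → F) :
    OrdF e 0 (fun i x => f (x, c i)) := by
  refine ⟨M, hf.1, fun i a b h h' => ?_⟩
  have := hf.four (a, c i) (b, c i) (h, 0) (h', 0)
  rw [pair_norm, pair_norm, Prod.norm_mk, norm_zero, max_eq_left (norm_nonneg _)] at this
  simpa using this

theorem OrdF.bilin (he : ∀ i, 0 ≤ e i) {j k : ℕ} {f : ι → W → E} {g : ι → F}
    (hf : OrdF e j f) (hg : Sz e k g) (B : E → F → G) {K : ℝ} (hK : 0 ≤ K)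
    (hB : ∀ a b, ‖B a b‖ ≤ K * ‖a‖ * ‖b‖)
    (hB2 : ∀ a a' b, B (a - a') b = B a b - B a' b) :
    OrdF e (j + k) (fun i x => B (f i x) (g i)) := by
  obtain ⟨C, hC, hf⟩ := hf
  obtain ⟨C', hC', hg⟩ := hg
  refine ⟨K * C * C', by positivity, fun i a b h h' => ?_⟩
  have := he i
  rw [← hB2, ← hB2, ← hB2]
  have a1 := hf i a b h h'
  have a2 := hg i
  calc _ ≤ _ := hB _ _
    _ ≤ K * (C * e i ^ j * (‖h - h'‖ + ‖a - b‖ * ‖h'‖)) * (C' * e i ^ k) := by gcongr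
    _ = _ := by rw [pow_add]; ring

theorem OrdF.lower (he : ∀ i, 0 ≤ e i) {B : ℝ} (hB : ∀ i, e i ≤ B) (hB0 : 0 ≤ B) {k j : ℕ}
    (hjk : j ≤ k) {f : ι → W → E} (hf : OrdF e k f) : OrdF e j f := by
  obtain ⟨C, hC, hf⟩ := hf
  have key : ∀ i, C * e i ^ k ≤ C * B ^ (k - j) * e i ^ j := by
    intro i
    have := he i
    calc C * e i ^ k = C * (e i ^ (k - j) * e i ^ j) := by rw [← pow_add]; congr 3; omega
      _ ≤ C * (B ^ (k - j) * e i ^ j) := by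
        have := hB i
        gcongr
      _ = _ := by ring
  refine ⟨C * B ^ (k - j), by positivity, fun i a b h h' => (hf i a b h h').trans ?_⟩
  have := key i
  gcongr

end Calculus

end SDDE

set_option linter.unusedSectionVars false
set_option linter.unusedVariables false

namespace SDDE

open Set Filter Topology

section Apply2

variable {d : ℕ} {E : Type*} [NormedAddCommGroup E] [NormedSpace ℝ E]

theorem apply2_sub_left (ζ ζ' : (Fin d → ℝ) →L[ℝ] ((Fin d → ℝ) →L[ℝ] E)) (M : Fin d → Fin d → ℝ) :
    apply2 (ζ - ζ') M = apply2 ζ M - apply2 ζ' M := by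
  simp [apply2, smul_sub, Finset.sum_sub_distrib]

theorem apply2_add_left (ζ ζ' : (Fin d → ℝ) →L[ℝ] ((Fin d → ℝ) →L[ℝ] E)) (M : Fin d → Fin d → ℝ) :
    apply2 (ζ + ζ') M = apply2 ζ M + apply2 ζ' M := by
  simp [apply2, smul_add, Finset.sum_add_distrib]

theorem apply2_add_right (ζ : (Fin d → ℝ) →L[ℝ] ((Fin d → ℝ) →L[ℝ] E)) (M N : Fin d → Fin d → ℝ) :
    apply2 ζ (M + N) = apply2 ζ M + apply2 ζ N := by
  simp [apply2, add_smul, Finset.sum_add_distrib]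

theorem apply2_sub_right (ζ : (Fin d → ℝ) →L[ℝ] ((Fin d → ℝ) →L[ℝ] E)) (M N : Fin d → Fin d → ℝ) :
    apply2 ζ (M - N) = apply2 ζ M - apply2 ζ N := by
  simp [apply2, sub_smul, Finset.sum_sub_distrib]

theorem apply2_norm (ζ : (Fin d → ℝ) →L[ℝ] ((Fin d → ℝ) →L[ℝ] E)) (M : Fin d → Fin d → ℝ) :
    ‖apply2 ζ M‖ ≤ ((d : ℝ) * d) * ‖ζ‖ * ‖M‖ := by
  have h : ∀ i j, ‖M i j • ζ (Pi.single i 1) (Pi.single j 1)‖ ≤ ‖ζ‖ * ‖M‖ := by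
    intro i j
    rw [norm_smul]
    have h1 : ‖M i j‖ ≤ ‖M‖ := (norm_le_pi_norm (M i) j).trans (norm_le_pi_norm M i)
    have h2 : ‖ζ (Pi.single i 1) (Pi.single j 1)‖ ≤ ‖ζ‖ * ‖(Pi.single i 1 : Fin d → ℝ)‖ *
      ‖(Pi.single j 1 : Fin d → ℝ)‖ := ζ.le_opNorm₂ _ _
    rw [Pi.norm_single, Pi.norm_single, norm_one, mul_one, mul_one] at h2
    calc _ ≤ ‖M‖ * ‖ζ‖ := by gcongr
      _ = _ := mul_comm _ _
  calc _ ≤ ∑ i : Fin d, ∑ j : Fin d, ‖ζ‖ * ‖M‖ := by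
        unfold apply2
        exact norm_sum_le_of_le _ fun i _ => norm_sum_le_of_le _ fun j _ => h i j
    _ = _ := by simp; ring

theorem apply2_tensor (ζ : (Fin d → ℝ) →L[ℝ] ((Fin d → ℝ) →L[ℝ] E)) (a b : Fin d → ℝ) :
    apply2 ζ (fun i j => a i * b j) = ζ a b := by
  have ha : a = ∑ i, a i • (Pi.single i 1 : Fin d → ℝ) := by
    simpa using (pi_eq_sum_univ' a)
  have hb : b = ∑ i, b i • (Pi.single i 1 : Fin d → ℝ) := by
    simpa using (pi_eq_sum_univ' b)
  conv_rhs => rw [ha, hb]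
  simp only [map_sum, map_smul, _root_.sum_apply, _root_.smul_apply, apply2]
  rw [Finset.sum_comm]
  simp only [Finset.smul_sum, smul_smul, mul_comm]

variable {W : Type*} [NormedAddCommGroup W] [NormedSpace ℝ W] {ι : Type*} {e : ι → ℝ}

theorem Ord.apply2 (he : ∀ i, 0 ≤ e i) {j k : ℕ}
    {f : ι → W → (Fin d → ℝ) →L[ℝ] ((Fin d → ℝ) →L[ℝ] E)} {M : ι → Fin d → Fin d → ℝ}
    (hf : Ord e j f) (hM : Sz e k M) : Ord e (j + k) (fun i x => apply2 (f i x) (M i)) := by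
  refine hf.bilin he (hM.ord he) SDDE.apply2 (K := (d : ℝ) * d) (by positivity) apply2_norm ?_
  intro a a' b b'
  rw [apply2_sub_left, apply2_sub_right]; abel

theorem OrdF.apply2 (he : ∀ i, 0 ≤ e i) {j k : ℕ}
    {f : ι → W → (Fin d → ℝ) →L[ℝ] ((Fin d → ℝ) →L[ℝ] E)} {M : ι → Fin d → Fin d → ℝ}
    (hf : OrdF e j f) (hM : Sz e k M) : OrdF e (j + k) (fun i x => apply2 (f i x) (M i)) :=
  hf.bilin he hM SDDE.apply2 (K := (d : ℝ) * d) (by positivity) apply2_norm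
    (fun a a' b => apply2_sub_left _ _ _)

end Apply2

section Germ

variable {d : ℕ} {W : Type*} [NormedAddCommGroup W] [NormedSpace ℝ W]

/-- The coefficient `σ_x σ`. -/
noncomputable def gX (σ : W × W → (Fin d → ℝ) →L[ℝ] W) (p : W × W) :
    (Fin d → ℝ) →L[ℝ] ((Fin d → ℝ) →L[ℝ] W) := (sigmaX σ p).comp (σ p)

/-- One step of the second order scheme. -/
noncomputable def GG (σ : W × W → (Fin d → ℝ) →L[ℝ] W) (η : W) (η' : (Fin d → ℝ) →L[ℝ] W)
    (a : Fin d → ℝ) (M N : Fin d → Fin d → ℝ) (x : W) : W :=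
  σ (x, η) a + apply2 (gX σ (x, η)) M + apply2 ((sigmaY σ (x, η)).comp η') N

theorem CnBounded.four_sm2 {σ : W × W → (Fin d → ℝ) →L[ℝ] W} (hσ : CnBounded 3 σ) :
    ∃ M, Sm2 σ M ∧ Sm2 (_root_.fderiv ℝ σ) M ∧ Sm2 (gX σ) M ∧ Sm2 (sigmaY σ) M := by
  have h2 : CnBounded 2 σ := hσ.of_le (by norm_num)
  have hd : CnBounded 2 (_root_.fderiv ℝ σ) := CnBounded.fderiv (n := 2) hσ
  have hx : CnBounded 2 (sigmaX σ) := by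
    have := hd.clm (F := W →L[ℝ] (Fin d → ℝ) →L[ℝ] W) ((ContinuousLinearMap.compL ℝ W (W × W) ((Fin d → ℝ) →L[ℝ] W)).flip
        (ContinuousLinearMap.inl ℝ W W))
    exact this
  have hy : CnBounded 2 (sigmaY σ) := by
    have := hd.clm (F := W →L[ℝ] (Fin d → ℝ) →L[ℝ] W) ((ContinuousLinearMap.compL ℝ W (W × W) ((Fin d → ℝ) →L[ℝ] W)).flip
        (ContinuousLinearMap.inr ℝ W W))
    exact this
  have hg : CnBounded 2 (gX σ) := by
    have := hx.bilin (G := (Fin d → ℝ) →L[ℝ] (Fin d → ℝ) →L[ℝ] W) h2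
      (ContinuousLinearMap.compL ℝ (Fin d → ℝ) W ((Fin d → ℝ) →L[ℝ] W))
    exact this
  obtain ⟨M1, a1, b1, c1, d1, e1⟩ := h2.sm2
  obtain ⟨M2, a2, b2, c2, d2, e2⟩ := hd.sm2
  obtain ⟨M3, a3, b3, c3, d3, e3⟩ := hg.sm2
  obtain ⟨M4, a4, b4, c4, d4, e4⟩ := hy.sm2
  refine ⟨M1 + M2 + M3 + M4, ⟨by positivity, b1, fun p => (c1 p).trans (by linarith),
    fun p => (d1 p).trans (by linarith), fun p q => (e1 p q).trans ?_⟩,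
    ⟨by positivity, b2, fun p => (c2 p).trans (by linarith),
    fun p => (d2 p).trans (by linarith), fun p q => (e2 p q).trans ?_⟩,
    ⟨by positivity, b3, fun p => (c3 p).trans (by linarith),
    fun p => (d3 p).trans (by linarith), fun p q => (e3 p q).trans ?_⟩,
    ⟨by positivity, b4, fun p => (c4 p).trans (by linarith),
    fun p => (d4 p).trans (by linarith), fun p q => (e4 p q).trans ?_⟩⟩ <;>
  · gcongr
    linarith

variable {ι : Type*} {e : ι → ℝ} {σ : W × W → (Fin d → ℝ) →L[ℝ] W} {K B : ℝ}

theorem GG_ord2 (he : ∀ i, 0 ≤ e i) (h3 : Sm2 (gX σ) K)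
    (h4 : Sm2 (sigmaY σ) K) (c : ι → W) {c' : ι → (Fin d → ℝ) →L[ℝ] W} (hc' : Sz e 0 c')
    {M N : ι → Fin d → Fin d → ℝ} (hM : Sz e 2 M) (hN : Sz e 2 N) :
    Ord e 2 (fun i (x : W) => apply2 (gX σ (x, c i)) (M i) +
      apply2 ((sigmaY σ (x, c i)).comp (c' i)) (N i)) := by
  have A1 := (Ord.smooth (e := e) h3 c).apply2 he hM
  have A2 := ((Ord.smooth (e := e) h4 c).clm_comp he (hc'.ord he)).apply2 he hN
  exact A1.add A2

theorem GG_ord (he : ∀ i, 0 ≤ e i) (hB : ∀ i, e i ≤ B) (hB0 : 0 ≤ B) (h1 : Sm2 σ K)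
    (h3 : Sm2 (gX σ) K)
    (h4 : Sm2 (sigmaY σ) K) (c : ι → W) {c' : ι → (Fin d → ℝ) →L[ℝ] W} (hc' : Sz e 0 c')
    {a : ι → Fin d → ℝ} (ha : Sz e 1 a)
    {M N : ι → Fin d → Fin d → ℝ} (hM : Sz e 2 M) (hN : Sz e 2 N) :
    Ord e 1 (fun i (x : W) => GG σ (c i) (c' i) (a i) (M i) (N i) x) := by
  have A0 := (Ord.smooth (e := e) h1 c).clm_apply he (ha.ord he)
  have A1 := (GG_ord2 he h3 h4 c hc' hM hN).lower he hB hB0 (j := 1) (by norm_num)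
  have := A0.add A1
  simpa only [GG, add_assoc] using this

theorem GG_ordF (he : ∀ i, 0 ≤ e i) (hB : ∀ i, e i ≤ B) (hB0 : 0 ≤ B) (h1 : Sm2 σ K)
    (h3 : Sm2 (gX σ) K)
    (h4 : Sm2 (sigmaY σ) K) (c : ι → W) {c' : ι → (Fin d → ℝ) →L[ℝ] W} (hc' : Sz e 0 c')
    {a : ι → Fin d → ℝ} (ha : Sz e 1 a)
    {M N : ι → Fin d → Fin d → ℝ} (hM : Sz e 2 M) (hN : Sz e 2 N) :
    OrdF e 1 (fun i (x : W) => GG σ (c i) (c' i) (a i) (M i) (N i) x) := by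
  have A0 : OrdF e (0 + 1) (fun i (x : W) => σ (x, c i) (a i)) :=
    (OrdF.smooth (e := e) h1 c).bilin he ha (fun (L : (Fin d → ℝ) →L[ℝ] W) v => L v) zero_le_one
      (fun L v => by rw [one_mul]; exact L.le_opNorm v) (fun _ _ _ => by simp)
  have A1 := ((OrdF.smooth (e := e) h3 c).apply2 he hM).lower he hB hB0 (j := 1) (by norm_num)
  have A2 : OrdF e (0 + 0) (fun i (x : W) => (sigmaY σ (x, c i)).comp (c' i)) :=
    (OrdF.smooth (e := e) h4 c).bilin he hc'
      (fun (L : W →L[ℝ] (Fin d → ℝ) →L[ℝ] W) (v : (Fin d → ℝ) →L[ℝ] W) => L.comp v) zero_le_one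
      (fun L v => by rw [one_mul]; exact L.opNorm_comp_le v) (fun _ _ _ => by ext; simp)
  have A3 := (A2.apply2 he hN).lower he hB hB0 (j := 1) (by norm_num)
  exact (A0.add A1).add A3

theorem defect_ord (he : ∀ i, 0 ≤ e i) (hB : ∀ i, e i ≤ B) (hB0 : 0 ≤ B) (h1 : Sm2 σ K)
    (h2 : Sm2 (fderiv ℝ σ) K) (h3 : Sm2 (gX σ) K) (h4 : Sm2 (sigmaY σ) K)
    (c : ι → W) {dc : ι → W} (hdc : Sz e 1 dc)
    {c' c2' : ι → (Fin d → ℝ) →L[ℝ] W} (hc' : Sz e 0 c') (hc2' : Sz e 0 c2')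
    (hdc' : Sz e 1 (fun i => c2' i - c' i))
    {a1 a2 ad : ι → Fin d → ℝ} (ha1 : Sz e 1 a1) (ha2 : Sz e 1 a2)
    (hrem : Sz e 2 (fun i => dc i - c' i (ad i)))
    {M1 N1 M2 N2 : ι → Fin d → Fin d → ℝ} (hM1 : Sz e 2 M1) (hN1 : Sz e 2 N1)
    (hM2 : Sz e 2 M2) (hN2 : Sz e 2 N2) :
    Ord e 3 (fun i (x : W) =>
      GG σ (c i + dc i) (c2' i) (a2 i) (M2 i) (N2 i)
        (x + GG σ (c i) (c' i) (a1 i) (M1 i) (N1 i) x) +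
      GG σ (c i) (c' i) (a1 i) (M1 i) (N1 i) x -
      GG σ (c i) (c' i) (a1 i + a2 i) (M1 i + M2 i + fun k l => a1 i k * a2 i l)
        (N1 i + N2 i + fun k l => ad i k * a2 i l) x) := by
  have Hh : Ord e 1 (fun i (x : W) => (GG σ (c i) (c' i) (a1 i) (M1 i) (N1 i) x, dc i)) :=
    (GG_ord he hB hB0 h1 h3 h4 c hc' ha1 hM1 hN1).prodMk he (hdc.ord he)
  have T1 := Ord.taylor he h1 h2 c Hh
  have R2 := (GG_ord2 he h3 h4 c hc' hM1 hN1).prodMk he (hrem.ord (W := W) he)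
  have T2 := (Ord.smooth (e := e) h2 c).clm_apply he R2
  have F1 := (T1.add T2).clm_apply he (ha2.ord he)
  have F2 := (Ord.diff he h3 c Hh).apply2 he hM2
  have F3a := (Ord.diff he h4 c Hh).clm_comp he (hc2'.ord he)
  have F3b := (Ord.smooth (e := e) h4 c).clm_comp he (hdc'.ord he)
  have F3 := ((F3a.lower he hB hB0 (j := 1) (by norm_num)).add
    (F3b.lower he hB hB0 (j := 1) (by norm_num))).apply2 he hN2
  have := (F1.add F2).add F3
  refine Eq.mp ?_ this
  congr 1
  funext i x
  have hp : ∀ z : W, (x, c i) + (z, dc i) = (x + z, c i + dc i) := fun z => rfl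
  simp only [hp]
  have hD : fderiv ℝ σ (x, c i) (GG σ (c i) (c' i) (a1 i) (M1 i) (N1 i) x, dc i) =
      fderiv ℝ σ (x, c i) (apply2 (gX σ (x, c i)) (M1 i) +
        apply2 ((sigmaY σ (x, c i)).comp (c' i)) (N1 i), dc i - c' i (ad i)) +
      (gX σ (x, c i) (a1 i) + (sigmaY σ (x, c i)).comp (c' i) (ad i)) := by
    simp only [gX, sigmaX, sigmaY, ContinuousLinearMap.comp_apply, ContinuousLinearMap.inl_apply,
      ContinuousLinearMap.inr_apply, ← map_add, GG]
    congr 1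
    simp only [Prod.mk_add_mk, Prod.mk.injEq]
    constructor <;> abel
  rw [hD]
  generalize fderiv ℝ σ (x, c i) (apply2 (gX σ (x, c i)) (M1 i) +
        apply2 ((sigmaY σ (x, c i)).comp (c' i)) (N1 i), dc i - c' i (ad i)) = Q
  have e1 : (sigmaY σ (x + GG σ (c i) (c' i) (a1 i) (M1 i) (N1 i) x, c i + dc i) -
      sigmaY σ (x, c i)).comp (c2' i) + (sigmaY σ (x, c i)).comp (c2' i - c' i) =
      (sigmaY σ (x + GG σ (c i) (c' i) (a1 i) (M1 i) (N1 i) x, c i + dc i)).comp (c2' i) -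
      (sigmaY σ (x, c i)).comp (c' i) := by
    ext; simp
  rw [e1]
  generalize hy : x + GG σ (c i) (c' i) (a1 i) (M1 i) (N1 i) x = y
  simp only [GG, apply2_sub_left, apply2_add_right, apply2_tensor, map_add, _root_.sub_apply,
    _root_.add_apply]
  abel

end Germ

end SDDE

set_option linter.unusedSectionVars false
set_option linter.unusedVariables false

namespace SDDE

open Set Filter Topology

/-- Ordered triples in `[0,r]`. -/
structure Tri (r : ℝ) : Type where
  u : ℝ
  w : ℝ
  v : ℝ
  h0 : 0 ≤ u
  h1 : u ≤ w
  h2 : w ≤ v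
  h3 : v ≤ r

/-- The size of a triple. -/
noncomputable def Tri.e {r : ℝ} (β : ℝ) (i : Tri r) : ℝ := (i.v - i.u) ^ β

section

variable {d : ℕ} {r γ β : ℝ} {W : Type*} [NormedAddCommGroup W] [NormedSpace ℝ W]
  {E : Type*} [NormedAddCommGroup E]

theorem Tri.sz (hβ : 0 < β) (k : ℕ) {p : ℝ} (hp : β * k ≤ p) {G : Tri r → E} (C : ℝ)
    (hG : ∀ i, ∃ t, 0 ≤ t ∧ t ≤ i.v - i.u ∧ ‖G i‖ ≤ C * t ^ p) : Sz (Tri.e β) k G := by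
  by_cases hr : 0 ≤ r
  swap
  · exact ⟨0, le_rfl, fun i => absurd (i.h0.trans (i.h1.trans (i.h2.trans i.h3))) hr⟩
  have hk : 0 ≤ β * k := by positivity
  refine ⟨|C| * r ^ (p - β * k), by positivity, fun i => ?_⟩
  obtain ⟨t, ht0, ht, h⟩ := hG i
  have hvu : 0 ≤ i.v - i.u := ht0.trans ht
  have hvr : i.v - i.u ≤ r := by have := i.h0; have := i.h3; linarith
  calc ‖G i‖ ≤ C * t ^ p := h
    _ ≤ |C| * t ^ p := by gcongr; exact le_abs_self C
    _ ≤ |C| * (i.v - i.u) ^ p := by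
      have : 0 ≤ p := hk.trans hp
      gcongr
    _ = |C| * ((i.v - i.u) ^ (p - β * k) * (i.v - i.u) ^ (β * k)) := by
      rw [← Real.rpow_add_of_nonneg hvu (by linarith) hk]; congr 2; ring
    _ ≤ |C| * (r ^ (p - β * k) * (i.v - i.u) ^ (β * k)) := by
      have : 0 ≤ p - β * k := by linarith
      gcongr
    _ = _ := by rw [Tri.e, Real.rpow_mul_natCast hvu, mul_assoc]

/-- The second order scheme for the frozen equation. -/
noncomputable def AA (RP : DelayedRoughPath d r γ) (σ : W × W → (Fin d → ℝ) →L[ℝ] W)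
    (ξ : ℝ → W) (ξ' : ℝ → (Fin d → ℝ) →L[ℝ] W) (u v : ℝ) (x : W) : W :=
  GG σ (ξ (u - r)) (ξ' (u - r)) (RP.X v - RP.X u) (RP.XX u v) (RP.XXd u v) x

theorem holder_bound {I : Set ℝ} {f : ℝ → E} {q : ℝ} (h : HolderOn q I f) :
    ∃ C, ∀ s t, s ∈ I → t ∈ I → s ≤ t → ‖f t - f s‖ ≤ C * (t - s) ^ q := by
  obtain ⟨C, h⟩ := h
  refine ⟨C, fun s t hs ht hst => ?_⟩
  have := h s hs t ht
  rwa [abs_of_nonneg (by linarith)] at this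

theorem holder2_bound {I : Set ℝ} {f : ℝ → ℝ → E} {q : ℝ} (h : Holder2On q I f) :
    ∃ C, ∀ s t, s ∈ I → t ∈ I → s ≤ t → ‖f s t‖ ≤ C * (t - s) ^ q := by
  obtain ⟨C, h⟩ := h
  refine ⟨C, fun s t hs ht hst => ?_⟩
  have := h s hs t ht
  rwa [abs_of_nonneg (by linarith)] at this

theorem exists_AF (hr : 0 < r) (hβ1 : 1 / 3 < β) (hβγ : β < γ)
    (RP : DelayedRoughPath d r γ)
    (σ : W × W → (Fin d → ℝ) →L[ℝ] W) (hσ : CnBounded 3 σ)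
    (ξ : ℝ → W) (ξ' : ℝ → (Fin d → ℝ) →L[ℝ] W)
    (hξ : IsControlled β RP.X (Icc (-r) 0) ξ ξ') :
    ∃ C, AF (AA RP σ ξ ξ') r β C ∧
      (∀ u v, 0 ≤ u → u ≤ v → v ≤ r → ‖RP.X v - RP.X u‖ ≤ C * (v - u) ^ β) ∧
      (∀ u v, 0 ≤ u → u ≤ v → v ≤ r → ‖ξ (v - r) - ξ (u - r)‖ ≤ C * (v - u) ^ β) ∧
      (∀ u v, 0 ≤ u → u ≤ v → v ≤ r → ∀ x, ‖AA RP σ ξ ξ' u v x - σ (x, ξ (u - r)) (RP.X v - RP.X u)‖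
        ≤ C * (v - u) ^ (2 * β)) ∧
      (∀ p, ‖σ p‖ ≤ C) ∧ (∀ p q, ‖σ p - σ q‖ ≤ C * ‖p - q‖) := by
  have hβ : 0 < β := by linarith
  obtain ⟨K, s1, s2, s3, s4⟩ := hσ.four_sm2
  have he : ∀ i : Tri r, 0 ≤ Tri.e β i := fun i => by
    have := i.h1; have := i.h2
    exact Real.rpow_nonneg (by linarith) _
  have hB : ∀ i : Tri r, Tri.e β i ≤ r ^ β := fun i => by
    have := i.h0; have := i.h1; have := i.h2; have := i.h3
    exact Real.rpow_le_rpow (by linarith) (by linarith) hβ.le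
  have hB0 : 0 ≤ r ^ β := by positivity
  obtain ⟨CX, hX⟩ := holder_bound (RP.holX 0 r)
  obtain ⟨CXd, hXd⟩ := holder_bound (RP.holX (-r) 0)
  obtain ⟨CXX, hXX⟩ := holder2_bound (RP.holXX 0 r)
  obtain ⟨CXXd, hXXd⟩ := holder2_bound (RP.holXXd 0 r)
  obtain ⟨Cx, hx'⟩ := holder_bound hξ.1
  have hrem0 : Holder2On (2 * β) (Icc (-r) 0)
      (fun s t => ξ t - ξ s - ξ' s (RP.X t - RP.X s)) := hξ.2
  obtain ⟨CR, hR⟩ := holder2_bound hrem0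
  have zX : ∀ f g : Tri r → ℝ, (∀ i, i.u ≤ f i ∧ f i ≤ g i ∧ g i ≤ i.v) →
      Sz (Tri.e β) 1 (fun i => RP.X (g i) - RP.X (f i)) := by
    intro f g hfg
    refine Tri.sz hβ 1 (p := γ) (by push_cast; linarith) CX fun i => ?_
    obtain ⟨a, b, c⟩ := hfg i
    have := i.h0; have := i.h3
    exact ⟨g i - f i, by linarith, by linarith, hX _ _ ⟨by linarith, by linarith⟩ ⟨by linarith, by linarith⟩ b⟩
  have zXX : ∀ f g : Tri r → ℝ, (∀ i, i.u ≤ f i ∧ f i ≤ g i ∧ g i ≤ i.v) →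
      Sz (Tri.e β) 2 (fun i => RP.XX (f i) (g i)) := by
    intro f g hfg
    refine Tri.sz hβ 2 (p := 2 * γ) (by push_cast; linarith) CXX fun i => ?_
    obtain ⟨a, b, c⟩ := hfg i
    have := i.h0; have := i.h3
    exact ⟨g i - f i, by linarith, by linarith, hXX _ _ ⟨by linarith, by linarith⟩ ⟨by linarith, by linarith⟩ b⟩
  have zXXd : ∀ f g : Tri r → ℝ, (∀ i, i.u ≤ f i ∧ f i ≤ g i ∧ g i ≤ i.v) →
      Sz (Tri.e β) 2 (fun i => RP.XXd (f i) (g i)) := by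
    intro f g hfg
    refine Tri.sz hβ 2 (p := 2 * γ) (by push_cast; linarith) CXXd fun i => ?_
    obtain ⟨a, b, c⟩ := hfg i
    have := i.h0; have := i.h3
    exact ⟨g i - f i, by linarith, by linarith, hXXd _ _ ⟨by linarith, by linarith⟩ ⟨by linarith, by linarith⟩ b⟩
  have mem : ∀ t, 0 ≤ t → t ≤ r → t - r ∈ Icc (-r) 0 := fun t h h' => ⟨by linarith, by linarith⟩
  have zXm : Sz (Tri.e β) 1 (fun i : Tri r => RP.X (i.w - r) - RP.X (i.u - r)) := by
    refine Tri.sz hβ 1 (p := γ) (by push_cast; linarith) CXd fun i => ?_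
    have := i.h0; have := i.h1; have := i.h2; have := i.h3
    refine ⟨i.w - i.u, by linarith, by linarith, ?_⟩
    have := hXd (i.u - r) (i.w - r) (mem _ (by linarith) (by linarith))
      (mem _ (by linarith) (by linarith)) (by linarith)
    rwa [sub_sub_sub_cancel_right] at this
  have bξ' : ∃ C, ∀ t, 0 ≤ t → t ≤ r → ‖ξ' (t - r)‖ ≤ C := by
    refine ⟨‖ξ' (-r)‖ + |Cx| * r ^ β, fun t h0 h1 => ?_⟩
    have h := hx' (-r) (t - r) ⟨le_rfl, by linarith⟩ (mem t h0 h1) (by linarith)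
    have e1 : t - r - -r = t := by ring
    rw [e1] at h
    have h2 : Cx * t ^ β ≤ |Cx| * r ^ β := by
      gcongr
      exact le_abs_self _
    have h3 := norm_add_le (ξ' (-r)) (ξ' (t - r) - ξ' (-r))
    rw [add_sub_cancel] at h3
    linarith
  obtain ⟨Cb, hb⟩ := bξ'
  have zc : ∀ f : Tri r → ℝ, (∀ i, i.u ≤ f i ∧ f i ≤ i.v) →
      Sz (Tri.e β) 0 (fun i => ξ' (f i - r)) := by
    intro f hf
    refine ⟨|Cb|, abs_nonneg _, fun i => ?_⟩
    have := i.h0; have := i.h3; have := hf i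
    rw [pow_zero, mul_one]
    exact (hb _ (by linarith) (by linarith)).trans (le_abs_self _)
  have zdc' : Sz (Tri.e β) 1 (fun i : Tri r => ξ' (i.w - r) - ξ' (i.u - r)) := by
    refine Tri.sz hβ 1 (p := β) (by push_cast; linarith) Cx fun i => ?_
    have := i.h0; have := i.h1; have := i.h2; have := i.h3
    refine ⟨i.w - i.u, by linarith, by linarith, ?_⟩
    have := hx' (i.u - r) (i.w - r) (mem _ (by linarith) (by linarith))
      (mem _ (by linarith) (by linarith)) (by linarith)
    rwa [sub_sub_sub_cancel_right] at this
  have zrem : Sz (Tri.e β) 2 (fun i : Tri r => ξ (i.w - r) - ξ (i.u - r) -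
      ξ' (i.u - r) (RP.X (i.w - r) - RP.X (i.u - r))) := by
    refine Tri.sz hβ 2 (p := 2 * β) (by push_cast; linarith) CR fun i => ?_
    have := i.h0; have := i.h1; have := i.h2; have := i.h3
    refine ⟨i.w - i.u, by linarith, by linarith, ?_⟩
    have := hR (i.u - r) (i.w - r) (mem _ (by linarith) (by linarith))
      (mem _ (by linarith) (by linarith)) (by linarith)
    rwa [sub_sub_sub_cancel_right] at this
  have zdc : Sz (Tri.e β) 1 (fun i : Tri r => ξ (i.w - r) - ξ (i.u - r)) := by
    have a1 := (zrem.ord (W := ℝ) he).lower he hB hB0 (j := 1) (by norm_num)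
    have a2 := ((zc (fun i => i.u) (fun i => ⟨le_rfl, i.h1.trans i.h2⟩)).ord (W := ℝ) he).clm_apply
      he (zXm.ord he)
    obtain ⟨C, hC, h⟩ := a1.add a2
    refine ⟨C, hC, fun i => ?_⟩
    have := (h i).1 0
    dsimp only at this ⊢
    rwa [sub_add_cancel] at this
  have huv : ∀ i : Tri r, i.u ≤ i.u ∧ i.u ≤ i.v ∧ i.v ≤ i.v :=
    fun i => ⟨le_rfl, i.h1.trans i.h2, le_rfl⟩
  have huw : ∀ i : Tri r, i.u ≤ i.u ∧ i.u ≤ i.w ∧ i.w ≤ i.v := fun i => ⟨le_rfl, i.h1, i.h2⟩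
  have hwv : ∀ i : Tri r, i.u ≤ i.w ∧ i.w ≤ i.v ∧ i.v ≤ i.v := fun i => ⟨i.h1, i.h2, le_rfl⟩
  have zcu := zc (fun i => i.u) (fun i => ⟨le_rfl, i.h1.trans i.h2⟩)
  have zcw := zc (fun i => i.w) (fun i => ⟨i.h1, i.h2⟩)
  have O1 := GG_ord he hB hB0 s1 s3 s4 (fun i : Tri r => ξ (i.u - r)) zcu
    (zX _ _ huv) (zXX _ _ huv) (zXXd _ _ huv)
  have O2 := GG_ordF he hB hB0 s1 s3 s4 (fun i : Tri r => ξ (i.u - r)) zcu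
    (zX _ _ huv) (zXX _ _ huv) (zXXd _ _ huv)
  have O3 := defect_ord he hB hB0 s1 s2 s3 s4 (fun i : Tri r => ξ (i.u - r)) zdc zcu zcw zdc'
    (zX _ _ huw) (zX _ _ hwv) zrem (zXX _ _ huw) (zXXd _ _ huw) (zXX _ _ hwv) (zXXd _ _ hwv)
  obtain ⟨C1, hC1, O1⟩ := O1
  obtain ⟨C2, hC2, O2⟩ := O2
  obtain ⟨C3, hC3, O3⟩ := O3
  have key : ∀ i : Tri r, ∀ x, AA RP σ ξ ξ' i.w i.v (x + AA RP σ ξ ξ' i.u i.w x) +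
      AA RP σ ξ ξ' i.u i.w x - AA RP σ ξ ξ' i.u i.v x =
      GG σ (ξ (i.u - r) + (ξ (i.w - r) - ξ (i.u - r))) (ξ' (i.w - r)) (RP.X i.v - RP.X i.w)
        (RP.XX i.w i.v) (RP.XXd i.w i.v)
        (x + GG σ (ξ (i.u - r)) (ξ' (i.u - r)) (RP.X i.w - RP.X i.u) (RP.XX i.u i.w) (RP.XXd i.u i.w) x) +
      GG σ (ξ (i.u - r)) (ξ' (i.u - r)) (RP.X i.w - RP.X i.u) (RP.XX i.u i.w) (RP.XXd i.u i.w) x -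
      GG σ (ξ (i.u - r)) (ξ' (i.u - r)) (RP.X i.w - RP.X i.u + (RP.X i.v - RP.X i.w))
        (RP.XX i.u i.w + RP.XX i.w i.v + fun k l => (RP.X i.w - RP.X i.u) k * (RP.X i.v - RP.X i.w) l)
        (RP.XXd i.u i.w + RP.XXd i.w i.v +
          fun k l => (RP.X (i.w - r) - RP.X (i.u - r)) k * (RP.X i.v - RP.X i.w) l) x := by
    intro i x
    have c1 := RP.chen i.u i.w i.v
    have c2 := RP.chend i.u i.w i.v
    simp only [Pi.sub_apply]
    rw [← c1, ← c2, sub_add_sub_cancel', add_sub_cancel]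
    rfl
  have pw : ∀ i : Tri r, Tri.e β i ^ 3 = (i.v - i.u) ^ (3 * β) := fun i => by
    have := i.h1; have := i.h2
    rw [Tri.e, ← Real.rpow_mul_natCast (by linarith)]
    congr 1
    push_cast; ring
  have p1 : ∀ i : Tri r, Tri.e β i ^ 1 = (i.v - i.u) ^ β := fun i => by rw [pow_one, Tri.e]
  have p2 : ∀ i : Tri r, Tri.e β i ^ 2 = (i.v - i.u) ^ (2 * β) := fun i => by
    have := i.h1; have := i.h2
    rw [Tri.e, ← Real.rpow_mul_natCast (by linarith)]
    congr 1
    push_cast; ring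
  obtain ⟨C4, hC4, O4⟩ := zX _ _ huv
  obtain ⟨C5, hC5, O5⟩ := zdc
  obtain ⟨C6, hC6, O6⟩ := GG_ord2 he s3 s4 (fun i : Tri r => ξ (i.u - r)) zcu
    (zXX _ _ huv) (zXXd _ _ huv)
  have hK := s1.1
  have up : ∀ {c l m : ℝ}, 0 ≤ l → c ≤ C1 + C2 + C3 + C4 + C5 + C6 + K → m ≤ c * l →
      m ≤ (C1 + C2 + C3 + C4 + C5 + C6 + K) * l := fun hl hc hm =>
    hm.trans (mul_le_mul_of_nonneg_right hc hl)
  have up2 : ∀ {c l m n : ℝ}, 0 ≤ l → 0 ≤ n → c ≤ C1 + C2 + C3 + C4 + C5 + C6 + K → m ≤ c * l * n →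
      m ≤ (C1 + C2 + C3 + C4 + C5 + C6 + K) * l * n := fun hl hn hc hm =>
    hm.trans (mul_le_mul_of_nonneg_right (mul_le_mul_of_nonneg_right hc hl) hn)
  have nn : ∀ {u v p : ℝ}, u ≤ v → 0 ≤ (v - u) ^ p := fun h => Real.rpow_nonneg (by linarith) _
  refine ⟨C1 + C2 + C3 + C4 + C5 + C6 + K, ⟨by positivity, hr, hβ1, ?_, ?_, ?_, ?_, ?_⟩, ?_, ?_, ?_,
    ?_, ?_⟩
  · intro u v h0 h1 h2 x
    have := (O1 ⟨u, u, v, h0, le_rfl, h1, h2⟩).1 x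
    rw [p1] at this
    exact up (nn h1) (by linarith) this
  · intro u v h0 h1 h2 x x'
    have := (O1 ⟨u, u, v, h0, le_rfl, h1, h2⟩).2 x x'
    rw [p1] at this
    exact up2 (nn h1) (norm_nonneg _) (by linarith) this
  · intro u v h0 h1 h2 a b h k
    have := O2 ⟨u, u, v, h0, le_rfl, h1, h2⟩ a b h k
    rw [p1] at this
    exact up2 (nn h1) (by positivity) (by linarith) this
  · intro u w v h0 h1 h2 h3 x
    have := (O3 ⟨u, w, v, h0, h1, h2, h3⟩).1 x
    rw [pw] at this
    dsimp only at this
    erw [← key ⟨u, w, v, h0, h1, h2, h3⟩] at this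
    exact up (nn (h1.trans h2)) (by linarith) this
  · intro u w v h0 h1 h2 h3 x x'
    have := (O3 ⟨u, w, v, h0, h1, h2, h3⟩).2 x x'
    rw [pw] at this
    dsimp only at this
    erw [← key ⟨u, w, v, h0, h1, h2, h3⟩, ← key ⟨u, w, v, h0, h1, h2, h3⟩] at this
    exact up2 (nn (h1.trans h2)) (norm_nonneg _) (by linarith) this
  · intro u v h0 h1 h2
    have := O4 ⟨u, u, v, h0, le_rfl, h1, h2⟩
    rw [p1] at this
    exact up (nn h1) (by linarith) this
  · intro u v h0 h1 h2
    have := O5 ⟨u, v, v, h0, h1, le_rfl, h2⟩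
    rw [p1] at this
    exact up (nn h1) (by linarith) this
  · intro u v h0 h1 h2 x
    have := (O6 ⟨u, u, v, h0, le_rfl, h1, h2⟩).1 x
    rw [p2] at this
    have e1 : AA RP σ ξ ξ' u v x - σ (x, ξ (u - r)) (RP.X v - RP.X u) =
        apply2 (gX σ (x, ξ (u - r))) (RP.XX u v) +
        apply2 ((sigmaY σ (x, ξ (u - r))).comp (ξ' (u - r))) (RP.XXd u v) := by
      rw [AA, GG]; abel
    rw [e1]
    exact up (nn h1) (by linarith) this
  · intro p
    exact (s1.2.2.1 p).trans (by linarith)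
  · intro p q
    exact up (norm_nonneg _) (by linarith) (s1.lip p q)

end

end SDDE

set_option linter.unusedSectionVars false
set_option linter.unusedVariables false

namespace SDDE

open Set Filter Topology

section Parts

variable {E : Type*} [NormedAddCommGroup E]

theorem Partition.mono_le {s t : ℝ} (P : Partition s t) {i j : ℕ} (hij : i ≤ j) (hj : j ≤ P.n) :
    P.pts i ≤ P.pts j := by
  induction j, hij using Nat.le_induction with
  | base => exact le_rfl
  | succ j h ih => exact (ih (by omega)).trans (P.mono j (by omega))

theorem Partition.left_le {s t : ℝ} (P : Partition s t) {i : ℕ} (hi : i ≤ P.n) : s ≤ P.pts i := by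
  have := P.mono_le (Nat.zero_le i) hi
  rwa [P.h0] at this

theorem Partition.le_right {s t : ℝ} (P : Partition s t) {i : ℕ} (hi : i ≤ P.n) : P.pts i ≤ t := by
  have := P.mono_le hi le_rfl
  rwa [P.hn] at this

/-- Sum of a germ along a partition. -/
def psum (a : ℝ → ℝ → E) {s t : ℝ} (P : Partition s t) : E :=
  ∑ i ∈ Finset.range P.n, a (P.pts i) (P.pts (i + 1))

/-- Points of the concatenation. -/
noncomputable def catPts {s u t : ℝ} (P : Partition s u) (Q : Partition u t) (i : ℕ) : ℝ :=
  if i ≤ P.n then P.pts i else Q.pts (i - P.n)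

theorem catPts_left {s u t : ℝ} (P : Partition s u) (Q : Partition u t) {i : ℕ} (hi : i ≤ P.n) :
    catPts P Q i = P.pts i := if_pos hi

theorem catPts_right {s u t : ℝ} (P : Partition s u) (Q : Partition u t) (j : ℕ) :
    catPts P Q (P.n + j) = Q.pts j := by
  rcases Nat.eq_zero_or_pos j with rfl | hj
  · rw [add_zero, catPts_left P Q le_rfl, P.hn, Q.h0]
  · rw [catPts, if_neg (by omega)]; congr 1; omega

/-- Concatenation of partitions. -/
noncomputable def Partition.cat {s u t : ℝ} (P : Partition s u) (Q : Partition u t) :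
    Partition s t where
  n := P.n + Q.n
  pts := catPts P Q
  h0 := by rw [catPts_left P Q (Nat.zero_le _), P.h0]
  hn := by rw [catPts_right, Q.hn]
  mono := by
    intro i hi
    rcases Nat.lt_or_ge i P.n with h | h
    · rw [catPts_left P Q h.le, catPts_left P Q h]; exact P.mono i h
    · obtain ⟨j, rfl⟩ := Nat.exists_eq_add_of_le h
      rw [add_assoc, catPts_right, catPts_right]; exact Q.mono j (by omega)

theorem Partition.cat_mesh {s u t δ : ℝ} {P : Partition s u} {Q : Partition u t}
    (hP : P.MeshLE δ) (hQ : Q.MeshLE δ) : (P.cat Q).MeshLE δ := by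
  intro i hi
  change i < P.n + Q.n at hi
  change catPts P Q (i + 1) - catPts P Q i ≤ δ
  rcases Nat.lt_or_ge i P.n with h | h
  · rw [catPts_left P Q h.le, catPts_left P Q h]; exact hP i h
  · obtain ⟨j, rfl⟩ := Nat.exists_eq_add_of_le h
    rw [add_assoc, catPts_right, catPts_right]; exact hQ j (by omega)

theorem Partition.cat_psum (a : ℝ → ℝ → E) {s u t : ℝ} (P : Partition s u) (Q : Partition u t) :
    psum a (P.cat Q) = psum a P + psum a Q := by
  change ∑ i ∈ Finset.range (P.n + Q.n), a (catPts P Q i) (catPts P Q (i + 1)) = _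
  rw [Finset.sum_range_add]
  congr 1
  · refine Finset.sum_congr rfl fun i hi => ?_
    have := Finset.mem_range.1 hi
    rw [catPts_left P Q this.le, catPts_left P Q this]
  · refine Finset.sum_congr rfl fun j hj => ?_
    rw [add_assoc, catPts_right, catPts_right]

/-- The one-step partition. -/
noncomputable def Partition.one {s t : ℝ} (h : s ≤ t) : Partition s t where
  n := 1
  pts := fun i => if i = 0 then s else t
  h0 := by simp
  hn := by simp
  mono := by
    intro i hi
    obtain rfl : i = 0 := by omega
    simpa using h

theorem sewing {a : ℝ → ℝ → E} {s r θ c : ℝ} (hθ : 1 < θ) (hc : 0 ≤ c)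
    (ha : ∀ u w v, s ≤ u → u ≤ w → w ≤ v → v ≤ r → ‖a u w + a w v - a u v‖ ≤ c * (v - u) ^ θ) :
    ∃ K, 0 ≤ K ∧ ∀ n : ℕ, ∀ u v, s ≤ u → u ≤ v → v ≤ r → ∃ P : Partition u v,
      P.MeshLE ((v - u) / 2 ^ n) ∧ ‖psum a P - a u v‖ ≤ K * (v - u) ^ θ := by
  have hh := half_rpow_lt hθ
  set q : ℝ := (1 / 2 : ℝ) ^ θ with hq
  have hpos : 0 < 1 - 2 * q := by linarith
  refine ⟨c / (1 - 2 * q), by positivity, fun n => ?_⟩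
  set K := c / (1 - 2 * q) with hK
  have hK0 : 0 ≤ K := by positivity
  have hKc : K * (1 - 2 * q) = c := div_mul_cancel₀ _ hpos.ne'
  induction n with
  | zero =>
    intro u v hu huv hv
    refine ⟨Partition.one huv, ?_, ?_⟩
    · intro i hi
      obtain rfl : i = 0 := by change i < 1 at hi; omega
      simp [Partition.one]
    · have : psum a (Partition.one huv) = a u v := by simp [psum, Partition.one]
      rw [this, sub_self, norm_zero]
      have : 0 ≤ v - u := by linarith
      positivity
  | succ n ih =>
    intro u v hu huv hv
    obtain ⟨P, hP1, hP2⟩ := ih u ((u + v) / 2) hu (by linarith) (by linarith)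
    obtain ⟨Q, hQ1, hQ2⟩ := ih ((u + v) / 2) v (by linarith) (by linarith) hv
    have e1 : (u + v) / 2 - u = (v - u) / 2 := by ring
    have e2 : v - (u + v) / 2 = (v - u) / 2 := by ring
    have e3 : (v - u) / 2 / 2 ^ n = (v - u) / 2 ^ (n + 1) := by rw [div_div, pow_succ']
    rw [e1] at hP1 hP2
    rw [e2] at hQ1 hQ2
    rw [e3] at hP1 hQ1
    refine ⟨P.cat Q, Partition.cat_mesh hP1 hQ1, ?_⟩
    rw [Partition.cat_psum]
    have h1 := ha u ((u + v) / 2) v hu (by linarith) (by linarith) hv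
    have h2 := half_len_rpow (θ := θ) (l := v - u) (m := (v - u) / 2) (by linarith) (by linarith)
      le_rfl
    rw [← hq] at h2
    have h3 : K * ((v - u) / 2) ^ θ ≤ K * (q * (v - u) ^ θ) := by gcongr
    calc _ = ‖(psum a P - a u ((u + v) / 2)) + (psum a Q - a ((u + v) / 2) v) +
          (a u ((u + v) / 2) + a ((u + v) / 2) v - a u v)‖ := by congr 1; abel
      _ ≤ K * (q * (v - u) ^ θ) + K * (q * (v - u) ^ θ) + c * (v - u) ^ θ :=
        norm_add_le_of_le (norm_add_le_of_le (hP2.trans h3) (hQ2.trans h3)) h1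
      _ = (K * (2 * q) + K * (1 - 2 * q)) * (v - u) ^ θ := by rw [hKc]; ring
      _ = _ := by ring

/-- `v` is the limit of germ sums. -/
def HasLim (a : ℝ → ℝ → E) (s t : ℝ) (v : E) : Prop :=
  ∀ ε > (0:ℝ), ∃ δ > (0:ℝ), ∀ P : Partition s t, P.MeshLE δ → ‖psum a P - v‖ ≤ ε

theorem exists_mesh {l δ : ℝ} (hδ : 0 < δ) : ∃ N : ℕ, ∀ n ≥ N, l / 2 ^ n ≤ δ := by
  obtain ⟨N, hN⟩ := pow_unbounded_of_one_lt (l / δ) (one_lt_two (α := ℝ))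
  refine ⟨N, fun n hn => ?_⟩
  rw [div_le_iff₀ (by positivity), ← div_le_iff₀' hδ]
  exact hN.le.trans (pow_le_pow_right₀ one_le_two hn)

theorem sewing_lim {a : ℝ → ℝ → E} {s r θ c : ℝ} {y : ℝ → E} {x : E} (hθ : 1 < θ) (hc : 0 ≤ c)
    (ha : ∀ u w v, s ≤ u → u ≤ w → w ≤ v → v ≤ r → ‖a u w + a w v - a u v‖ ≤ c * (v - u) ^ θ)
    (hl : ∀ t ∈ Icc s r, HasLim a s t (y t - x)) :
    ∃ K, 0 ≤ K ∧ ∀ u v, s ≤ u → u ≤ v → v ≤ r → ‖y v - y u - a u v‖ ≤ K * (v - u) ^ θ := by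
  obtain ⟨K, hK, h⟩ := sewing hθ hc ha
  refine ⟨K, hK, fun u v hu huv hv => le_of_forall_pos_le_add fun ε hε => ?_⟩
  obtain ⟨δ1, hδ1, H1⟩ := hl u ⟨hu, huv.trans hv⟩ (ε / 2) (by positivity)
  obtain ⟨δ2, hδ2, H2⟩ := hl v ⟨hu.trans huv, hv⟩ (ε / 2) (by positivity)
  have hδ : 0 < min δ1 δ2 := lt_min hδ1 hδ2
  obtain ⟨N1, hN1⟩ := exists_mesh (l := u - s) hδ
  obtain ⟨N2, hN2⟩ := exists_mesh (l := v - u) hδ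
  obtain ⟨P, hP, -⟩ := h N1 s u le_rfl hu (huv.trans hv)
  obtain ⟨Q, hQ, hQ2⟩ := h N2 u v hu huv hv
  have hP' : P.MeshLE (min δ1 δ2) := fun i hi => (hP i hi).trans (hN1 _ le_rfl)
  have hQ' : Q.MeshLE (min δ1 δ2) := fun i hi => (hQ i hi).trans (hN2 _ le_rfl)
  have b1 := H1 P (fun i hi => (hP' i hi).trans (min_le_left _ _))
  have b2 := H2 (P.cat Q) (fun i hi => (Partition.cat_mesh hP' hQ' i hi).trans (min_le_right _ _))
  rw [Partition.cat_psum, norm_sub_rev] at b2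
  calc _ = ‖(y v - x - (psum a P + psum a Q)) + (psum a P - (y u - x)) + (psum a Q - a u v)‖ := by
        congr 1; abel
    _ ≤ ε / 2 + ε / 2 + K * (v - u) ^ θ := norm_add_le_of_le (norm_add_le_of_le b2 b1) hQ2
    _ = _ := by ring

theorem lim_of_davie {a : ℝ → ℝ → E} {s r θ K : ℝ} {y : ℝ → E} (hθ : 1 < θ) (hK : 0 ≤ K)
    (h : ∀ u v, s ≤ u → u ≤ v → v ≤ r → ‖y v - y u - a u v‖ ≤ K * (v - u) ^ θ)
    {t : ℝ} (ht : t ∈ Icc s r) : HasLim a s t (y t - y s) := by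
  intro ε hε
  have hst : 0 ≤ t - s := by linarith [ht.1]
  obtain ⟨δ, hδ, H⟩ := exists_small K (ε / (t - s + 1)) (θ - 1) hK (by positivity) (by linarith)
  refine ⟨δ, hδ, fun P hP => ?_⟩
  have e1 : y t - y s = ∑ i ∈ Finset.range P.n, (y (P.pts (i + 1)) - y (P.pts i)) := by
    rw [Finset.sum_range_sub (fun i => y (P.pts i)), P.hn, P.h0]
  have e2 : t - s = ∑ i ∈ Finset.range P.n, (P.pts (i + 1) - P.pts i) := by
    rw [Finset.sum_range_sub (fun i => P.pts i), P.hn, P.h0]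
  rw [norm_sub_rev, psum, e1, ← Finset.sum_sub_distrib]
  calc _ ≤ ∑ i ∈ Finset.range P.n, ε / (t - s + 1) * (P.pts (i + 1) - P.pts i) := by
        refine norm_sum_le_of_le _ fun i hi => ?_
        have hi := Finset.mem_range.1 hi
        have hm := P.mono i hi
        have hm' : 0 ≤ P.pts (i + 1) - P.pts i := by linarith
        refine (h _ _ (P.left_le hi.le) hm ((P.le_right hi).trans ht.2)).trans ?_
        have e3 : (P.pts (i + 1) - P.pts i) ^ θ =
            (P.pts (i + 1) - P.pts i) ^ (θ - 1) * (P.pts (i + 1) - P.pts i) := by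
          have := Real.rpow_add_of_nonneg hm' (by linarith : 0 ≤ θ - 1) zero_le_one
          rwa [sub_add_cancel, Real.rpow_one] at this
        rw [e3, ← mul_assoc]
        have := H _ hm' (hP i hi)
        gcongr
    _ = ε / (t - s + 1) * (t - s) := by rw [← Finset.mul_sum, ← e2]
    _ ≤ ε / (t - s + 1) * (t - s + 1) := by gcongr; linarith
    _ = ε := by field_simp

end Parts

theorem pow_split {t r p q : ℝ} (h0 : 0 ≤ t) (h1 : t ≤ r) (hq : 0 ≤ q) (hqp : q ≤ p) :
    t ^ p ≤ r ^ (p - q) * t ^ q := by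
  have : 0 ≤ p - q := by linarith
  calc t ^ p = t ^ (p - q) * t ^ q := by
        rw [← Real.rpow_add_of_nonneg h0 (by linarith) hq, sub_add_cancel]
    _ ≤ _ := by gcongr

section

variable {d : ℕ} {r γ β : ℝ} {W : Type*} [NormedAddCommGroup W] [NormedSpace ℝ W]

theorem holderOn_of {E : Type*} [NormedAddCommGroup E] {f : ℝ → E} {s r q C : ℝ}
    (h : ∀ u v, s ≤ u → u ≤ v → v ≤ r → ‖f v - f u‖ ≤ C * (v - u) ^ q) :
    HolderOn q (Icc s r) f := by
  refine ⟨C, fun u hu v hv => ?_⟩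
  rcases le_total u v with huv | huv
  · rw [abs_of_nonneg (by linarith)]; exact h u v hu.1 huv hv.2
  · rw [norm_sub_rev, abs_sub_comm, abs_of_nonneg (by linarith)]; exact h v u hv.1 huv hu.2

theorem frozen_of_davie {RP : DelayedRoughPath d r γ} {σ : W × W → (Fin d → ℝ) →L[ℝ] W}
    {ξ : ℝ → W} {ξ' : ℝ → (Fin d → ℝ) →L[ℝ] W} {C : ℝ} (hA : AF (AA RP σ ξ ξ') r β C)
    (hX : ∀ u v, 0 ≤ u → u ≤ v → v ≤ r → ‖RP.X v - RP.X u‖ ≤ C * (v - u) ^ β)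
    (hxi : ∀ u v, 0 ≤ u → u ≤ v → v ≤ r → ‖ξ (v - r) - ξ (u - r)‖ ≤ C * (v - u) ^ β)
    (h2 : ∀ u v, 0 ≤ u → u ≤ v → v ≤ r → ∀ x,
      ‖AA RP σ ξ ξ' u v x - σ (x, ξ (u - r)) (RP.X v - RP.X u)‖ ≤ C * (v - u) ^ (2 * β))
    (hlip : ∀ p q, ‖σ p - σ q‖ ≤ C * ‖p - q‖)
    {s K : ℝ} (hs : 0 ≤ s) {y : ℝ → W} (hK : 0 ≤ K) (hD : Davie (AA RP σ ξ ξ') r β s K y) :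
    IsFrozenSol RP σ β ξ ξ' s (y s) y := by
  have hC := hA.hC
  have hr := hA.hr
  have hβ : 0 < β := by linarith [hA.hβ]
  have hy : ∀ u v, s ≤ u → u ≤ v → v ≤ r →
      ‖y v - y u‖ ≤ (K * r ^ (3 * β - β) + C) * (v - u) ^ β := by
    intro u v hu huv hv
    have a1 := hD u v hu huv hv
    have a2 := hA.bd u v (hs.trans hu) huv hv (y u)
    have a3 := pow_split (t := v - u) (r := r) (p := 3 * β) (q := β) (by linarith) (by linarith)
      hβ.le (by linarith)
    calc _ = ‖(y v - y u - AA RP σ ξ ξ' u v (y u)) + AA RP σ ξ ξ' u v (y u)‖ := by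
          rw [sub_add_cancel]
      _ ≤ K * (r ^ (3 * β - β) * (v - u) ^ β) + C * (v - u) ^ β :=
        norm_add_le_of_le (a1.trans (by gcongr)) a2
      _ = _ := by ring
  set D := K * r ^ (3 * β - β) + C with hDdef
  have hD0 : 0 ≤ D := by positivity
  have hy' : ∀ u v, s ≤ u → u ≤ v → v ≤ r →
      ‖σ (y v, ξ (v - r)) - σ (y u, ξ (u - r))‖ ≤ C * (D + C) * (v - u) ^ β := by
    intro u v hu huv hv
    have a1 := hy u v hu huv hv
    have a2 := hxi u v (hs.trans hu) huv hv
    have a0 : 0 ≤ (v - u) ^ β := Real.rpow_nonneg (by linarith) _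
    refine (hlip _ _).trans ?_
    rw [mul_assoc]
    gcongr
    rw [Prod.mk_sub_mk, Prod.norm_mk]
    refine max_le ?_ ?_ <;> nlinarith
  have hrem : ∀ u v, s ≤ u → u ≤ v → v ≤ r →
      ‖y v - y u - σ (y u, ξ (u - r)) (RP.X v - RP.X u)‖ ≤
        (K * r ^ (3 * β - 2 * β) + C) * (v - u) ^ (2 * β) := by
    intro u v hu huv hv
    have a1 := hD u v hu huv hv
    have a2 := h2 u v (hs.trans hu) huv hv (y u)
    have a3 := pow_split (t := v - u) (r := r) (p := 3 * β) (q := 2 * β) (by linarith) (by linarith)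
      (by linarith) (by linarith)
    calc _ = ‖(y v - y u - AA RP σ ξ ξ' u v (y u)) +
          (AA RP σ ξ ξ' u v (y u) - σ (y u, ξ (u - r)) (RP.X v - RP.X u))‖ := by
          rw [sub_add_sub_cancel]
      _ ≤ K * (r ^ (3 * β - 2 * β) * (v - u) ^ (2 * β)) + C * (v - u) ^ (2 * β) :=
        norm_add_le_of_le (a1.trans (by gcongr)) a2
      _ = _ := by ring
  refine ⟨rfl, ⟨holderOn_of hy', K * r ^ (3 * β - 2 * β) + C + C * (D + C) * C, ?_⟩, ?_⟩
  · intro u hu v hv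
    rcases le_total u v with huv | huv
    · rw [abs_of_nonneg (by linarith)]
      refine (hrem u v hu.1 huv hv.2).trans ?_
      have : 0 ≤ v - u := by linarith
      have : 0 ≤ C * (D + C) * C := by positivity
      exact mul_le_mul_of_nonneg_right (by linarith) (by positivity)
    · rw [abs_sub_comm, abs_of_nonneg (by linarith)]
      have huv0 : 0 ≤ u - v := by linarith
      have b1 := hrem v u hv.1 huv hu.2
      have b2 := hy' v u hv.1 huv hu.2
      have b3 := hX v u (hs.trans hv.1) huv hu.2
      calc _ = ‖-(y u - y v - σ (y v, ξ (v - r)) (RP.X u - RP.X v)) +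
            (σ (y u, ξ (u - r)) - σ (y v, ξ (v - r))) (RP.X u - RP.X v)‖ := by
            congr 1
            rw [_root_.sub_apply, ← neg_sub (RP.X u) (RP.X v), map_neg]
            abel
        _ ≤ (K * r ^ (3 * β - 2 * β) + C) * (u - v) ^ (2 * β) +
            (C * (D + C) * (u - v) ^ β) * (C * (u - v) ^ β) := by
            refine norm_add_le_of_le (by rwa [norm_neg]) ?_
            refine (ContinuousLinearMap.le_opNorm _ _).trans ?_
            gcongr
        _ = _ := by
          have : (u - v) ^ (2 * β) = (u - v) ^ β * (u - v) ^ β := by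
            rw [two_mul, Real.rpow_add_of_nonneg huv0 hβ.le hβ.le]
          rw [this]; ring
  · intro t ht
    exact lim_of_davie (a := fun u v => AA RP σ ξ ξ' u v (y u)) (θ := 3 * β)
      (by linarith [hA.hβ]) hK hD ht

theorem davie_of_frozen {RP : DelayedRoughPath d r γ} {σ : W × W → (Fin d → ℝ) →L[ℝ] W}
    {ξ : ℝ → W} {ξ' : ℝ → (Fin d → ℝ) →L[ℝ] W} {C : ℝ} (hA : AF (AA RP σ ξ ξ') r β C)
    (h2 : ∀ u v, 0 ≤ u → u ≤ v → v ≤ r → ∀ x,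
      ‖AA RP σ ξ ξ' u v x - σ (x, ξ (u - r)) (RP.X v - RP.X u)‖ ≤ C * (v - u) ^ (2 * β))
    {s : ℝ} (hs : 0 ≤ s) {x : W} {y : ℝ → W} (hy : IsFrozenSol RP σ β ξ ξ' s x y) :
    ∃ K, 0 ≤ K ∧ Davie (AA RP σ ξ ξ') r β s K y := by
  have hC := hA.hC
  have hr := hA.hr
  have hβ : 0 < β := by linarith [hA.hβ]
  obtain ⟨-, ⟨-, R, hR⟩, hlim⟩ := hy
  have h3 : ∀ u v, s ≤ u → u ≤ v → v ≤ r →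
      ‖y v - y u - AA RP σ ξ ξ' u v (y u)‖ ≤ (|R| + C) * (v - u) ^ (2 * β) := by
    intro u v hu huv hv
    have a1 := hR u ⟨hu, huv.trans hv⟩ v ⟨hu.trans huv, hv⟩
    have a2 := h2 u v (hs.trans hu) huv hv (y u)
    rw [norm_sub_rev] at a2
    have h0 : 0 ≤ v - u := by linarith
    rw [abs_of_nonneg h0] at a1
    calc _ = ‖(y v - y u - σ (y u, ξ (u - r)) (RP.X v - RP.X u)) +
          (σ (y u, ξ (u - r)) (RP.X v - RP.X u) - AA RP σ ξ ξ' u v (y u))‖ := by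
          rw [sub_add_sub_cancel]
      _ ≤ |R| * (v - u) ^ (2 * β) + C * (v - u) ^ (2 * β) :=
        norm_add_le_of_le (a1.trans (by gcongr; exact le_abs_self R)) a2
      _ = _ := by ring
  refine sewing_lim (a := fun u v => AA RP σ ξ ξ' u v (y u)) (θ := 3 * β) (x := x)
    (c := C + C * (|R| + C)) (by linarith [hA.hβ]) (by positivity) ?_ hlim
  intro u w v hu huw hwv hv
  have a1 := hA.dbd u w v (hs.trans hu) huw hwv hv (y u)
  have a2 := hA.lip w v (hs.trans (hu.trans huw)) hwv hv (y w) (y u + AA RP σ ξ ξ' u w (y u))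
  rw [← sub_sub] at a2
  have a3 := h3 u w hu huw (hwv.trans hv)
  have n1 : 0 ≤ w - u := by linarith
  have n2 : 0 ≤ v - w := by linarith
  have n3 : 0 ≤ v - u := by linarith
  calc _ = ‖(AA RP σ ξ ξ' w v (y u + AA RP σ ξ ξ' u w (y u)) + AA RP σ ξ ξ' u w (y u) -
        AA RP σ ξ ξ' u v (y u)) +
        (AA RP σ ξ ξ' w v (y w) - AA RP σ ξ ξ' w v (y u + AA RP σ ξ ξ' u w (y u)))‖ := by
        congr 1; abel
    _ ≤ C * (v - u) ^ (3 * β) + C * (v - u) ^ β * ((|R| + C) * (v - u) ^ (2 * β)) := by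
        refine norm_add_le_of_le a1 (a2.trans ?_)
        refine mul_le_mul ?_ (a3.trans ?_) (norm_nonneg _) (by positivity)
        · gcongr
        · gcongr
    _ = C * (v - u) ^ (3 * β) + C * (|R| + C) * ((v - u) ^ β * (v - u) ^ (2 * β)) := by ring
    _ = _ := by
      rw [← Real.rpow_add_of_nonneg n3 hβ.le (by linarith)]
      have : β + 2 * β = 3 * β := by ring
      rw [this]; ring

end

end SDDE

open SDDE Set in
/-- the frozen-delay equation `y_t = x + ∫_s^t σ(y_τ, ξ_{τ-r}) d𝐗_τ`
on `[s,r]` has a unique solution `φ̄(s,·,x)` with Gubinelli derivative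
`σ(y_·, ξ_{·-r})`, and the flow property `φ̄(τ,t,x) = φ̄(s,t,φ̄(τ,s,x))` holds. -/
theorem frozen_flow_exists_unique
    {d : ℕ} {r γ β : ℝ} (hr : 0 < r) (hγ1 : 1 / 3 < γ) (hγ2 : γ ≤ 1 / 2)
    (hβ1 : 1 / 3 < β) (hβγ : β < γ)
    {W : Type*} [NormedAddCommGroup W] [NormedSpace ℝ W] [FiniteDimensional ℝ W]
    (RP : DelayedRoughPath d r γ)
    (σ : W × W → (Fin d → ℝ) →L[ℝ] W) (hσ : CnBounded 3 σ)
    (ξ : ℝ → W) (ξ' : ℝ → (Fin d → ℝ) →L[ℝ] W)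
    (hξ : IsControlled β RP.X (Icc (-r) 0) ξ ξ') :
    (∀ s ∈ Icc (0 : ℝ) r, ∀ x : W,
      IsFrozenSol RP σ β ξ ξ' s x (frozenFlow RP σ β ξ ξ' s x) ∧
        ∀ y₁ y₂ : ℝ → W, IsFrozenSol RP σ β ξ ξ' s x y₁ →
          IsFrozenSol RP σ β ξ ξ' s x y₂ → ∀ t ∈ Icc s r, y₁ t = y₂ t) ∧
    ∀ τ s t : ℝ, 0 ≤ τ → τ ≤ s → s ≤ t → t ≤ r → ∀ x : W,
      frozenFlow RP σ β ξ ξ' τ x t =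
        frozenFlow RP σ β ξ ξ' s (frozenFlow RP σ β ξ ξ' τ x s) t := by
  obtain ⟨C, hA, hX, hxi, h2, hbd, hlip⟩ := exists_AF hr hβ1 hβγ RP σ hσ ξ ξ' hξ
  have ex : ∀ s, 0 ≤ s → ∀ x, IsFrozenSol RP σ β ξ ξ' s x (frozenFlow RP σ β ξ ξ' s x) := by
    intro s hs x
    have h : ∃ y : ℝ → W, IsFrozenSol RP σ β ξ ξ' s x y := by
      obtain ⟨y, hy, K, hK, hD⟩ := hA.exists_davie hs x
      refine ⟨y, ?_⟩
      rw [← hy]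
      exact frozen_of_davie hA hX hxi h2 hlip hs hK hD
    unfold frozenFlow
    rw [dif_pos h]
    exact h.choose_spec
  refine ⟨fun s hs x => ⟨ex s hs.1 x, fun y₁ y₂ h₁ h₂ t ht => ?_⟩, fun τ s t h0 h1 h3 h4 x => ?_⟩
  · obtain ⟨K1, -, D1⟩ := davie_of_frozen hA h2 hs.1 h₁
    obtain ⟨K2, -, D2⟩ := davie_of_frozen hA h2 hs.1 h₂
    exact hA.uniq hs.1 D1 D2 (h₁.1.trans h₂.1.symm) t ht.1 ht.2
  · have hs := h0.trans h1
    have e2 := ex s hs (frozenFlow RP σ β ξ ξ' τ x s)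
    obtain ⟨K1, -, D1⟩ := davie_of_frozen hA h2 h0 (ex τ h0 x)
    obtain ⟨K2, -, D2⟩ := davie_of_frozen hA h2 hs e2
    exact hA.uniq hs (fun u v hu huv hv => D1 u v (h1.trans hu) huv hv) D2 e2.1.symm t h3 h4
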